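/- Let G be a planar graph and let a, b be vertices lying in a common connected component C_i of G but in no common biconnected component. Let B_a, B_b be block nodes of the BC-tree T_2(C_i) with a ∈ V(B_a), b ∈ V(B_b), and let the path from B_a to B_b in T_2(C_i) be B_a, c_1, B_1, c_2, ..., c_k, B_k, c_{k+1}, B_b, where the B_i are block nodes and the c_i are cut vertices. Then G + {a,b} is planar if and only if (a) G[V(B_a)] + {a, c_1} is planar, (b) G[V(B_b)] + {c_{k+1}, b} is planar, and (c) for each i ∈ [k], G[V(B_i)] + {c_i, c_{i+1}} is planar. -/

import Mathlib

open SimpleGraph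

/-- The graph `G` with the edge `{a,b}` inserted. -/
def addEdge {W : Type*} (G : SimpleGraph W) (a b : W) : SimpleGraph W :=
  G ⊔ SimpleGraph.fromEdgeSet {s(a, b)}

/-- `u` and `v` are joined by a walk all of whose vertices lie in `A`,
i.e. they are connected in the subgraph induced on `A`. -/
def ReachableWithin {W : Type*} (G : SimpleGraph W) (A : Set W) (u v : W) : Prop :=
  ∃ p : G.Walk u v, ∀ x ∈ p.support, x ∈ A

/-- The subgraph of `G` induced on the vertex set `A` is connected. -/
def ConnectedOn {W : Type*} (G : SimpleGraph W) (A : Set W) : Prop :=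
  A.Nonempty ∧ ∀ ⦃u⦄, u ∈ A → ∀ ⦃v⦄, v ∈ A → ReachableWithin G A u v

/-- The subgraph of `G` induced on `A` is biconnected: connected and without cut vertices. -/
def BiconnectedOn {W : Type*} (G : SimpleGraph W) (A : Set W) : Prop :=
  ConnectedOn G A ∧ ∀ w ∈ A, (A \ {w}).Nonempty → ConnectedOn G (A \ {w})

/-- `B` is (the vertex set of) a block of `G`: a maximal biconnected subgraph. -/
def IsBlock {W : Type*} (G : SimpleGraph W) (B : Set W) : Prop :=
  BiconnectedOn G B ∧ ∀ B' : Set W, B ⊆ B' → BiconnectedOn G B' → B' = B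

/-- The subgraph of `G` induced on `A` is `k`-connected: it has more than `k` vertices
and remains connected after deleting any fewer than `k` vertices. -/
def KConnectedOn {W : Type*} (k : ℕ) (G : SimpleGraph W) (A : Set W) : Prop :=
  (∃ f : Fin (k + 1) → W, Function.Injective f ∧ ∀ i, f i ∈ A) ∧
  ∀ S : Set W, S.Finite → S.ncard < k → ConnectedOn G (A \ S)

/-- `G` is `k`-connected. -/
def KConnected {W : Type*} (k : ℕ) (G : SimpleGraph W) : Prop :=
  KConnectedOn k G Set.univ

/-- Two walks with common endpoints are internally vertex-disjoint: they share no
vertices other than the endpoints. -/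
def IntDisjoint {W : Type*} (G : SimpleGraph W) {s t : W} (p q : G.Walk s t) : Prop :=
  ∀ x, x ∈ p.support → x ∈ q.support → x = s ∨ x = t

/-- The subgraph of `G` induced on the vertex set `A` (with edges only inside `A`),
as a graph on the ambient vertex type. -/
def inducedOn {W : Type*} (G : SimpleGraph W) (A : Set W) : SimpleGraph W :=
  SimpleGraph.fromRel (fun u v => u ∈ A ∧ v ∈ A ∧ G.Adj u v)

/-- A planar drawing of the part of the graph `G` induced on the vertex set `A`:
vertices are distinct points of the plane and edges are arcs that meet
only at shared endpoints. -/
structure PlanarDrawingOn {W : Type*} (G : SimpleGraph W) (A : Set W) where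
  pos : W → ℝ × ℝ
  pos_inj : Set.InjOn pos A
  arc : Sym2 W → Set (ℝ × ℝ)
  arc_spec : ∀ ⦃u v : W⦄, u ∈ A → v ∈ A → G.Adj u v →
    ∃ f : ℝ → ℝ × ℝ, ContinuousOn f (Set.Icc 0 1) ∧ Set.InjOn f (Set.Icc 0 1) ∧
      f 0 = pos u ∧ f 1 = pos v ∧ f '' Set.Icc 0 1 = arc s(u, v)
  arc_inter : ∀ ⦃e₁ e₂ : Sym2 W⦄, e₁ ∈ G.edgeSet → e₂ ∈ G.edgeSet →
    (∀ x ∈ e₁, x ∈ A) → (∀ x ∈ e₂, x ∈ A) → e₁ ≠ e₂ →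
    arc e₁ ∩ arc e₂ ⊆ {p : ℝ × ℝ | ∃ v ∈ A, v ∈ e₁ ∧ v ∈ e₂ ∧ p = pos v}
  pos_arc : ∀ ⦃e : Sym2 W⦄, e ∈ G.edgeSet → (∀ x ∈ e, x ∈ A) →
    ∀ v ∈ A, pos v ∈ arc e → v ∈ e

namespace PlanarDrawingOn

variable {W : Type*} {G : SimpleGraph W} {A : Set W}

/-- The set of points of the plane used by the drawing. -/
def image (D : PlanarDrawingOn G A) : Set (ℝ × ℝ) :=
  D.pos '' A ∪ ⋃ e ∈ {e : Sym2 W | e ∈ G.edgeSet ∧ ∀ x ∈ e, x ∈ A}, D.arc e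

/-- A face of a drawing: a connected component of the complement of the drawing. -/
def IsFace (D : PlanarDrawingOn G A) (F : Set (ℝ × ℝ)) : Prop :=
  ∃ x ∈ D.imageᶜ, F = connectedComponentIn D.imageᶜ x

/-- The outer face of a drawing is its unbounded face. -/
def IsOuterFace (D : PlanarDrawingOn G A) (F : Set (ℝ × ℝ)) : Prop :=
  D.IsFace F ∧ ¬ Bornology.IsBounded F

end PlanarDrawingOn

/-- A graph is planar if it admits a planar drawing. -/
def SimpleGraph.IsPlanar {W : Type*} (G : SimpleGraph W) : Prop :=
  Nonempty (PlanarDrawingOn G Set.univ)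

/-- All vertices of `S` lie on the boundary of a common face in a planar embedding of
the part of `G` induced on `A`. -/
def OnCommonFace {W : Type*} (G : SimpleGraph W) (A : Set W) (S : Set W) : Prop :=
  ∃ (D : PlanarDrawingOn G A) (F : Set (ℝ × ℝ)),
    D.IsFace F ∧ ∀ v ∈ S, D.pos v ∈ frontier F

/-- `w` is a cut vertex of `G`: its deletion disconnects two vertices that were connected. -/
def IsCutVertex {W : Type*} (G : SimpleGraph W) (w : W) : Prop :=
  ∃ u v : W, u ≠ w ∧ v ≠ w ∧ G.Reachable u v ∧ ¬ ReachableWithin G {w}ᶜ u v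

/-- The path `B_a, c_1, B_1, …, B_k, c_(k+1), B_b` in the BC-tree of the connected
component containing `a` and `b`, between the blocks `Bl 0 ∋ a` and `Bl (k+1) ∋ b`;
`c i` is the `i`-th cut vertex on the path, belonging to the blocks `Bl i` and `Bl (i+1)`. -/
structure BCPath {W : Type*} (G : SimpleGraph W) (a b : W) (k : ℕ) where
  Bl : Fin (k + 2) → Set W
  c : Fin (k + 1) → W
  isBlock : ∀ i, IsBlock G (Bl i)
  isCut : ∀ i, IsCutVertex G (c i)
  ha : a ∈ Bl 0
  hb : b ∈ Bl (Fin.last (k + 1))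
  linkL : ∀ i : Fin (k + 1), c i ∈ Bl i.castSucc
  linkR : ∀ i : Fin (k + 1), c i ∈ Bl i.succ
  Bl_inj : Function.Injective Bl
  c_inj : Function.Injective c


/-! ### Arcs in the complex plane -/

/-- `A` is a simple arc from `p` to `q`. -/
def IsArcC (A : Set ℂ) (p q : ℂ) : Prop :=
  ∃ f : ℝ → ℂ, ContinuousOn f (Set.Icc 0 1) ∧ Set.InjOn f (Set.Icc 0 1) ∧
    f 0 = p ∧ f 1 = q ∧ f '' Set.Icc 0 1 = A

lemma IsArcC.left_mem {A : Set ℂ} {p q : ℂ} (h : IsArcC A p q) : p ∈ A := by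
  obtain ⟨f, -, -, h0, -, rfl⟩ := h
  exact ⟨0, by simp, h0⟩

lemma IsArcC.right_mem {A : Set ℂ} {p q : ℂ} (h : IsArcC A p q) : q ∈ A := by
  obtain ⟨f, -, -, -, h1, rfl⟩ := h
  exact ⟨1, by simp, h1⟩

lemma IsArcC.ne {A : Set ℂ} {p q : ℂ} (h : IsArcC A p q) : p ≠ q := by
  obtain ⟨f, -, hi, h0, h1, rfl⟩ := h
  intro hpq
  have := hi (by simp : (0:ℝ) ∈ Set.Icc (0:ℝ) 1) (by simp : (1:ℝ) ∈ Set.Icc (0:ℝ) 1)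
    (by rw [h0, h1, hpq])
  norm_num at this

lemma IsArcC.isCompact {A : Set ℂ} {p q : ℂ} (h : IsArcC A p q) : IsCompact A := by
  obtain ⟨f, hc, -, -, -, rfl⟩ := h
  exact isCompact_Icc.image_of_continuousOn hc

lemma IsArcC.image {A : Set ℂ} {p q : ℂ} (h : IsArcC A p q) {φ : ℂ → ℂ}
    (hc : ContinuousOn φ A) (hi : Set.InjOn φ A) : IsArcC (φ '' A) (φ p) (φ q) := by
  obtain ⟨f, hfc, hfi, h0, h1, rfl⟩ := h
  refine ⟨φ ∘ f, hc.comp hfc (Set.mapsTo_image _ _), hi.comp hfi (Set.mapsTo_image _ _), ?_, ?_, ?_⟩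
  · simp [h0]
  · simp [h1]
  · rw [Set.image_comp]

lemma isArcC_of_param {f : ℝ → ℂ} {a b : ℝ} (hab : a < b) (hc : ContinuousOn f (Set.Icc a b))
    (hi : Set.InjOn f (Set.Icc a b)) : IsArcC (f '' Set.Icc a b) (f a) (f b) := by
  have him : (fun t : ℝ => (b - a) * t + a) '' Set.Icc 0 1 = Set.Icc a b := by
    rw [Set.image_affine_Icc' (by linarith)]
    simp
  have hmt : Set.MapsTo (fun t : ℝ => (b - a) * t + a) (Set.Icc 0 1) (Set.Icc a b) := by
    rw [← him]; exact Set.mapsTo_image _ _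
  refine ⟨f ∘ (fun t => (b - a) * t + a), hc.comp (by fun_prop) hmt, hi.comp ?_ hmt, ?_, ?_, ?_⟩
  · intro x _ y _ hxy
    have : (b - a) ≠ 0 := by linarith
    simpa [this] using hxy
  · simp
  · simp
  · rw [Set.image_comp, him]

lemma IsArcC.symm {A : Set ℂ} {p q : ℂ} (h : IsArcC A p q) : IsArcC A q p := by
  obtain ⟨f, hc, hi, h0, h1, rfl⟩ := h
  have him : (fun t : ℝ => 1 - t) '' Set.Icc 0 1 = Set.Icc (0:ℝ) 1 := by simp
  have hmt : Set.MapsTo (fun t : ℝ => 1 - t) (Set.Icc 0 1) (Set.Icc 0 1) := by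
    rw [Set.mapsTo_iff_image_subset, him]
  refine ⟨f ∘ (fun t => 1 - t), hc.comp (by fun_prop) hmt, hi.comp ?_ hmt, ?_, ?_, ?_⟩
  · intro x _ y _ hxy
    simpa using hxy
  · simp [h1]
  · simp [h0]
  · rw [Set.image_comp, him]

lemma IsArcC.trans {A B : Set ℂ} {p q r : ℂ} (hA : IsArcC A p q) (hB : IsArcC B q r)
    (hAB : ∀ z ∈ A, z ∈ B → z = q) : IsArcC (A ∪ B) p r := by
  obtain ⟨f, hfc, hfi, f0, f1, rfl⟩ := hA
  obtain ⟨g, hgc, hgi, g0, g1, rfl⟩ := hB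
  let F : ℝ → ℂ := fun t => if t ≤ 1 then f t else g (t - 1)
  have hF1 : Set.EqOn F f (Set.Icc 0 1) := fun t ht => by simp [F, ht.2]
  have hF2 : Set.EqOn F (fun t => g (t - 1)) (Set.Icc 1 2) := fun t ht => by
    rcases eq_or_lt_of_le ht.1 with h | h
    · subst h; simp [F, f1, g0]
    · simp [F, not_le.2 h]
  have hmt : Set.MapsTo (fun t : ℝ => t - 1) (Set.Icc 1 2) (Set.Icc 0 1) := by
    intro t ht; constructor <;> linarith [ht.1, ht.2]
  have hU : Set.Icc (0:ℝ) 2 = Set.Icc 0 1 ∪ Set.Icc 1 2 := by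
    rw [Set.Icc_union_Icc_eq_Icc] <;> norm_num
  have hc1 : ContinuousOn F (Set.Icc 0 1) := hfc.congr hF1
  have hc2 : ContinuousOn F (Set.Icc 1 2) := (hgc.comp (by fun_prop) hmt).congr hF2
  have hc : ContinuousOn F (Set.Icc 0 2) := by
    rw [hU]; exact hc1.union_of_isClosed hc2 isClosed_Icc isClosed_Icc
  have key : ∀ x ∈ Set.Icc (0:ℝ) 1, ∀ y ∈ Set.Icc (1:ℝ) 2, F x = F y → x = y := by
    intro x hx y hy hxy
    rw [hF1 hx, hF2 hy] at hxy
    have hy' := hmt hy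
    have hq := hAB (f x) ⟨x, hx, rfl⟩ ⟨y - 1, hy', hxy.symm⟩
    have hx1 : x = 1 := hfi hx (by simp) (by rw [hq, f1])
    have hy1 : y - 1 = 0 := hgi hy' (by simp) (by rw [g0, ← hq]; exact hxy.symm)
    linarith
  have hi : Set.InjOn F (Set.Icc 0 2) := by
    rw [hU]
    rintro x (hx | hx) y (hy | hy) hxy
    · rw [hF1 hx, hF1 hy] at hxy; exact hfi hx hy hxy
    · exact key x hx y hy hxy
    · exact (key y hy x hx hxy.symm).symm
    · rw [hF2 hx, hF2 hy] at hxy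
      have := hgi (hmt hx) (hmt hy) hxy
      simpa using this
  have := isArcC_of_param (by norm_num : (0:ℝ) < 2) hc hi
  have e1 : F 0 = p := by simp [F, f0]
  have e2 : F 2 = r := by simp [F]; norm_num [g1]
  have e3 : F '' Set.Icc 0 2 = f '' Set.Icc 0 1 ∪ g '' Set.Icc 0 1 := by
    rw [hU, Set.image_union, hF1.image_eq, hF2.image_eq]
    congr 1
    have : (fun t => g (t - 1)) '' Set.Icc 1 2 = g '' ((fun t : ℝ => t - 1) '' Set.Icc 1 2) := by
      rw [Set.image_image]
    rw [this, Set.image_sub_const_Icc]; norm_num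
  rwa [e1, e2, e3] at this

lemma isArcC_segment {p q : ℂ} (h : p ≠ q) : IsArcC (segment ℝ p q) p q := by
  refine ⟨AffineMap.lineMap p q, ?_, ?_, by simp, by simp, ?_⟩
  · exact AffineMap.lineMap_continuous.continuousOn
  · exact (AffineMap.lineMap_injective ℝ h).injOn
  · rw [segment_eq_image_lineMap]

/-- Straightening an arc near its starting point. -/
lemma IsArcC.straighten {A : Set ℂ} {p q : ℂ} (h : IsArcC A p q) {r : ℝ} (hr : 0 < r)
    (hq : q ∉ Metric.closedBall p r) :
    ∃ (x : ℂ) (A' : Set ℂ), dist x p = r ∧ x ∈ A ∧ IsArcC A' p q ∧ A' ⊆ A ∪ segment ℝ p x ∧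
      A' ∩ Metric.closedBall p r ⊆ segment ℝ p x ∧ segment ℝ p x ⊆ A' := by
  obtain ⟨f, hc, hi, f0, f1, rfl⟩ := h
  set S : Set ℝ := Set.Icc 0 1 ∩ f ⁻¹' Metric.closedBall p r with hS
  have hScl : IsCompact S :=
    isCompact_Icc.of_isClosed_subset (hc.preimage_isClosed_of_isClosed isClosed_Icc
      Metric.isClosed_closedBall) Set.inter_subset_left
  have h0S : (0:ℝ) ∈ S := ⟨by simp, by simp [f0, hr.le]⟩
  obtain ⟨t, htS, htmax⟩ := hScl.exists_isGreatest ⟨0, h0S⟩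
  have hafter : ∀ s, t < s → s ≤ 1 → f s ∉ Metric.closedBall p r := by
    intro s hs hs1 hmem
    exact absurd (htmax ⟨⟨htS.1.1.trans hs.le, hs1⟩, hmem⟩) (not_le.2 hs)
  have ht1 : t < 1 := lt_of_le_of_ne htS.1.2 (fun h => hq (by rw [← f1, ← h]; exact htS.2))
  have hdist : dist (f t) p = r := by
    apply le_antisymm htS.2
    by_contra hlt
    push Not at hlt
    have hcw : ContinuousWithinAt f (Set.Ioc t 1) t :=
      (hc t htS.1).mono (fun s hs => ⟨htS.1.1.trans hs.1.le, hs.2⟩)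
    have hev : ∀ᶠ s in nhdsWithin t (Set.Ioc t 1), dist (f s) p < r :=
      (hcw.dist continuousWithinAt_const).eventually_lt_const hlt
    have hne : (nhdsWithin t (Set.Ioc t 1)).NeBot := by
      rw [nhdsWithin_Ioc_eq_nhdsGT ht1]; infer_instance
    obtain ⟨s, hs, hs'⟩ := (hev.and self_mem_nhdsWithin).exists
    exact hafter s hs'.1 hs'.2 hs.le
  have hne : p ≠ f t := by
    intro h; rw [← h, _root_.dist_self] at hdist; exact hr.ne hdist
  have hsub : Set.Icc t 1 ⊆ Set.Icc 0 1 := Set.Icc_subset_Icc_left htS.1.1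
  have hB := isArcC_of_param ht1 (hc.mono hsub) (hi.mono hsub)
  have hseg : segment ℝ p (f t) ⊆ Metric.closedBall p r :=
    (convex_closedBall p r).segment_subset (by simp [hr.le]) htS.2
  have hBb : ∀ z ∈ f '' Set.Icc t 1, z ∈ Metric.closedBall p r → z = f t := by
    rintro z ⟨s, hs, rfl⟩ hz
    rcases eq_or_lt_of_le hs.1 with h | h
    · rw [h]
    · exact absurd hz (hafter s h hs.2)
  refine ⟨f t, segment ℝ p (f t) ∪ f '' Set.Icc t 1, hdist, ⟨t, htS.1, rfl⟩, ?_, ?_, ?_, ?_⟩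
  · rw [← f1]
    exact (isArcC_segment hne).trans hB (fun z hz hz' => hBb z hz' (hseg hz))
  · rintro z (hz | hz)
    · exact Or.inr hz
    · exact Or.inl (Set.image_mono hsub hz)
  · rintro z ⟨hz | hz, hz'⟩
    · exact hz
    · rw [hBb z hz hz']; exact right_mem_segment _ _ _
  · exact Set.subset_union_left


/-! ### Moving a point inside a connected open set -/

lemma homog_step {U : Set ℂ} {x y : ℂ} {r : ℝ} (hr : 0 < r) (hB : Metric.ball x r ⊆ U)
    (hy : ‖y - x‖ ≤ r / 2) : ∃ h : ℂ ≃ₜ ℂ, h x = y ∧ ∀ z, z ∉ U → h z = z := by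
  let h : ℂ → ℂ := fun z => z + ((max 0 (1 - ‖z - x‖ / r) : ℝ) : ℂ) * (y - x)
  have happ : ApproximatesLinearOn h ((ContinuousLinearEquiv.refl ℝ ℂ : ℂ ≃L[ℝ] ℂ) : ℂ →L[ℝ] ℂ)
      Set.univ (1/2 : NNReal) := by
    intro z _ z' _
    have e : h z - h z' - ((ContinuousLinearEquiv.refl ℝ ℂ : ℂ ≃L[ℝ] ℂ) : ℂ →L[ℝ] ℂ) (z - z')
        = ((max 0 (1 - ‖z - x‖ / r) - max 0 (1 - ‖z' - x‖ / r) : ℝ) : ℂ) * (y - x) := by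
      simp [h]; ring
    rw [e, norm_mul, Complex.norm_real, Real.norm_eq_abs]
    have h1 : |max 0 (1 - ‖z - x‖ / r) - max 0 (1 - ‖z' - x‖ / r)| ≤ ‖z - z'‖ / r := by
      rw [max_comm 0, max_comm 0]
      refine (abs_max_sub_max_le_abs _ _ _).trans ?_ |>.trans (?_ : |‖z' - x‖ - ‖z - x‖| / r ≤ _)
      · rw [show (1 - ‖z - x‖ / r) - (1 - ‖z' - x‖ / r) = (‖z' - x‖ - ‖z - x‖) / r by ring,
          abs_div, abs_of_pos hr]
      · apply div_le_div_of_nonneg_right _ hr.le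
        refine (abs_norm_sub_norm_le _ _).trans ?_
        rw [show z' - x - (z - x) = -(z - z') by ring, norm_neg]
    calc _ ≤ ‖z - z'‖ / r * (r / 2) := by gcongr
      _ = _ := by push_cast; field_simp
  have hN : Subsingleton ℂ ∨ (1/2 : NNReal) <
      ‖(((ContinuousLinearEquiv.refl ℝ ℂ : ℂ ≃L[ℝ] ℂ).symm : ℂ →L[ℝ] ℂ))‖₊⁻¹ := by
    right
    have : ((ContinuousLinearEquiv.refl ℝ ℂ).symm : ℂ →L[ℝ] ℂ) = ContinuousLinearMap.id ℝ ℂ := rfl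
    rw [this]
    have : ‖ContinuousLinearMap.id ℝ ℂ‖₊ = 1 := by
      ext; simp
    rw [this]
    rw [← NNReal.coe_lt_coe]; norm_num
  refine ⟨happ.toHomeomorph h hN, ?_, ?_⟩
  · change h x = y
    simp [h]
  · intro z hz
    change h z = z
    have : r ≤ ‖z - x‖ := by
      by_contra hlt
      push Not at hlt
      exact hz (hB (by rwa [Metric.mem_ball, dist_eq_norm]))
    have : 1 - ‖z - x‖ / r ≤ 0 := by
      rw [sub_nonpos, le_div_iff₀ hr]; linarith
    simp [h, max_eq_left this]

lemma homog {U : Set ℂ} (hU : IsOpen U) {C : Set ℂ} (hC : IsPreconnected C) (hCU : C ⊆ U) {x y : ℂ}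
    (hx : x ∈ C) (hy : y ∈ C) : ∃ h : ℂ ≃ₜ ℂ, h x = y ∧ ∀ z, z ∉ U → h z = z := by
  refine hC.induction₂ (fun x y => ∃ h : ℂ ≃ₜ ℂ, h x = y ∧ ∀ z, z ∉ U → h z = z) ?_ ?_ ?_ hx hy
  · intro x hx
    obtain ⟨r, hr, hB⟩ := Metric.isOpen_iff.1 hU x (hCU hx)
    apply Filter.Eventually.filter_mono nhdsWithin_le_nhds
    filter_upwards [Metric.ball_mem_nhds x (half_pos hr)] with y hy
    rw [Metric.mem_ball, dist_eq_norm] at hy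
    exact homog_step hr hB hy.le
  · rintro x y z _ _ _ ⟨h1, e1, f1⟩ ⟨h2, e2, f2⟩
    exact ⟨h1.trans h2, by simp [e1, e2], fun w hw => by simp [f1 w hw, f2 w hw]⟩
  · rintro x y _ _ ⟨h, e, f⟩
    exact ⟨h.symm, by simp [← e], fun w hw => by rw [Homeomorph.symm_apply_eq, f w hw]⟩

/-! ### Opening a slit -/

lemma csqrt_sq (z : ℂ) : (z ^ ((2:ℂ)⁻¹)) ^ 2 = z := by
  simp

lemma csqrt_continuousAt {z : ℂ} (hz : z ∈ Complex.slitPlane ∨ z = 0) :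
    ContinuousAt (fun z : ℂ => z ^ ((2:ℂ)⁻¹)) z := by
  rcases hz with hz | rfl
  · exact continuousAt_cpow_const hz
  · have h := Complex.continuousAt_cpow_zero_of_re_pos (z := (2:ℂ)⁻¹) (by norm_num)
    exact h.comp (f := fun z : ℂ => (z, (2:ℂ)⁻¹)) (by fun_prop)

lemma csqrt_re_pos {z : ℂ} (hz : z ∈ Complex.slitPlane) : 0 < (z ^ ((2:ℂ)⁻¹)).re := by
  have h0 : z ≠ 0 := Complex.slitPlane_ne_zero hz
  have harg := Complex.mem_slitPlane_iff_arg.1 hz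
  rw [Complex.cpow_def_of_ne_zero h0, Complex.exp_re]
  apply mul_pos (Real.exp_pos _)
  apply Real.cos_pos_of_mem_Ioo
  have him : (Complex.log z * (2:ℂ)⁻¹).im = Complex.arg z / 2 := by
    rw [show (2:ℂ)⁻¹ = ((2⁻¹ : ℝ) : ℂ) by push_cast; rfl, Complex.im_mul_ofReal, Complex.log_im]
    ring
  rw [him]
  have h1 := Complex.neg_pi_lt_arg z
  have h2 := lt_of_le_of_ne (Complex.arg_le_pi z) harg.1
  constructor <;> linarith

/-- The map opening the slit `(w,q)` onto the right half plane. -/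
noncomputable def slitMap (w q z : ℂ) : ℂ :=
  open Classical in
  if z = q then 0 else (((z - w) / (z - q)) ^ ((2:ℂ)⁻¹) - Complex.I)⁻¹

lemma slitMap_q (w q : ℂ) : slitMap w q q = 0 := by simp [slitMap]

lemma slitMap_w {w q : ℂ} (h : w ≠ q) : slitMap w q w = Complex.I := by
  simp [slitMap, h]

lemma slit_mem {w q z : ℂ} (hz : z ∉ openSegment ℝ w q) (hzw : z ≠ w)
    (hzq : z ≠ q) : (z - w) / (z - q) ∈ Complex.slitPlane := by
  by_contra hns
  apply hz
  rw [Complex.mem_slitPlane_iff, not_or, not_lt, not_not] at hns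
  set s := (z - w) / (z - q) with hs
  have hsr : s = ((s.re : ℝ) : ℂ) := by
    apply Complex.ext <;> simp [hns.2]
  set t := s.re with ht
  have hzq' : z - q ≠ 0 := sub_ne_zero.2 hzq
  have hzw' : z - w ≠ 0 := sub_ne_zero.2 hzw
  have ht0 : t ≠ 0 := by
    intro h0
    rw [h0] at hsr
    have : s ≠ 0 := div_ne_zero hzw' hzq'
    exact this (by simpa using hsr)
  have htneg : t < 0 := lt_of_le_of_ne hns.1 ht0
  have heq : z - w = (t : ℂ) * (z - q) := by
    rw [← hsr, hs]; field_simp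
  have h1t : (1 - t : ℝ) ≠ 0 := by linarith
  have h1tc : (1 - (t:ℂ)) ≠ 0 := by exact_mod_cast h1t
  have hpos : 0 < 1 - t := by linarith
  refine ⟨1 / (1 - t), -t / (1 - t), by positivity, div_pos (by linarith) hpos, by field_simp; ring, ?_⟩
  simp only [Complex.real_smul]
  push_cast
  field_simp
  linear_combination -heq

lemma slitMap_re_pos {w q z : ℂ} (hz : z ∉ openSegment ℝ w q) (hzw : z ≠ w) (hzq : z ≠ q) :
    0 < (slitMap w q z).re := by
  have h := csqrt_re_pos (slit_mem hz hzw hzq)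
  rw [slitMap, if_neg hzq, Complex.inv_re]
  apply div_pos
  · simpa using h
  · rw [Complex.normSq_pos]
    intro h0
    rw [sub_eq_zero] at h0
    rw [h0] at h
    simp at h

lemma csqrt_ne_I {z : ℂ} (hz : z ∈ Complex.slitPlane ∨ z = 0) : z ^ ((2:ℂ)⁻¹) - Complex.I ≠ 0 := by
  rcases hz with hz | rfl
  · have h := csqrt_re_pos hz
    intro h0
    rw [sub_eq_zero] at h0
    rw [h0] at h
    simp at h
  · simp

lemma slit_mem' {w q z : ℂ} (hz : z ∉ openSegment ℝ w q) (hzq : z ≠ q) :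
    (z - w) / (z - q) ∈ Complex.slitPlane ∨ (z - w) / (z - q) = 0 := by
  by_cases hzw : z = w
  · right; simp [hzw]
  · left; exact slit_mem hz hzw hzq

lemma slitMap_injOn {w q : ℂ} (hwq : w ≠ q) : Set.InjOn (slitMap w q) (openSegment ℝ w q)ᶜ := by
  have h0 : ∀ z, z ∉ openSegment ℝ w q → z ≠ q → slitMap w q z ≠ 0 := by
    intro z hz hzq
    rw [slitMap, if_neg hzq]
    exact inv_ne_zero (csqrt_ne_I (slit_mem' hz hzq))
  intro z hz z' hz' heq
  by_cases h1 : z = q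
  · by_cases h2 : z' = q
    · rw [h1, h2]
    · rw [h1, slitMap_q] at heq
      exact absurd heq.symm (h0 z' hz' h2)
  · by_cases h2 : z' = q
    · rw [h2, slitMap_q] at heq
      exact absurd heq (h0 z hz h1)
    · rw [slitMap, slitMap, if_neg h1, if_neg h2, inv_inj, sub_left_inj] at heq
      have := congrArg (fun x => x ^ 2) heq
      simp only [csqrt_sq] at this
      have a1 : z - q ≠ 0 := sub_ne_zero.2 h1
      have a2 : z' - q ≠ 0 := sub_ne_zero.2 h2
      rw [div_eq_div_iff a1 a2] at this
      have h3 : (z - z') * (w - q) = 0 := by linear_combination this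
      rcases mul_eq_zero.1 h3 with h | h
      · exact sub_eq_zero.1 h
      · exact absurd (sub_eq_zero.1 h) hwq

lemma slitMap_continuousOn {w q : ℂ} (hwq : w ≠ q) :
    ContinuousOn (slitMap w q) (openSegment ℝ w q)ᶜ := by
  intro z hz
  by_cases hzq : z = q
  · subst hzq
    have hd : Filter.Tendsto (fun y : ℂ => (y - w) / (y - z)) (nhdsWithin z {z}ᶜ)
        (Bornology.cobounded ℂ) := by
      have h1 : Filter.Tendsto (fun y : ℂ => (y - z) / (y - w)) (nhdsWithin z {z}ᶜ)
          (nhdsWithin 0 {0}ᶜ) := by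
        apply tendsto_nhdsWithin_of_tendsto_nhds_of_eventually_within
        · have : ContinuousAt (fun y : ℂ => (y - z) / (y - w)) z := by
            apply ContinuousAt.div (by fun_prop) (by fun_prop)
            exact sub_ne_zero.2 hwq.symm
          have h2 := this.tendsto
          simp only [sub_self, zero_div] at h2
          exact h2.mono_left nhdsWithin_le_nhds
        · have hw : ∀ᶠ y in nhdsWithin z {z}ᶜ, y ≠ w :=
            Filter.Eventually.filter_mono nhdsWithin_le_nhds
              (isOpen_ne.mem_nhds hwq.symm)
          filter_upwards [hw, self_mem_nhdsWithin] with y hy hy'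
          exact div_ne_zero (sub_ne_zero.2 hy') (sub_ne_zero.2 hy)
      have h2 := Filter.tendsto_inv₀_nhdsNE_zero.comp h1
      refine h2.congr (fun y => ?_)
      simp
    have hs : Filter.Tendsto (fun y : ℂ => ((y - w) / (y - z)) ^ ((2:ℂ)⁻¹)) (nhdsWithin z {z}ᶜ)
        (Bornology.cobounded ℂ) := by
      rw [← tendsto_norm_atTop_iff_cobounded]
      have h1 := tendsto_norm_atTop_iff_cobounded.2 hd
      have h2 := Real.tendsto_sqrt_atTop.comp h1
      refine h2.congr (fun y => ?_)
      simp only [Function.comp]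
      rw [Real.sqrt_eq_iff_mul_self_eq (norm_nonneg _) (norm_nonneg _), ← norm_mul, ← sq, csqrt_sq]
    have hi : Filter.Tendsto (fun y : ℂ => (((y - w) / (y - z)) ^ ((2:ℂ)⁻¹) - Complex.I)⁻¹)
        (nhdsWithin z {z}ᶜ) (nhds 0) := by
      apply Filter.tendsto_inv₀_cobounded.comp
      rw [← tendsto_norm_atTop_iff_cobounded] at hs ⊢
      refine Filter.tendsto_atTop_mono (fun y => ?_) (Filter.tendsto_atTop_add_const_right _ (-1) hs)
      have := norm_sub_norm_le (((y - w) / (y - z)) ^ ((2:ℂ)⁻¹)) Complex.I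
      rw [Complex.norm_I] at this
      linarith
    have hc : ContinuousAt (slitMap w z) z := by
      rw [continuousAt_iff_punctured_nhds, slitMap_q]
      refine hi.congr' ?_
      filter_upwards [self_mem_nhdsWithin] with y hy
      rw [slitMap, if_neg (show ¬ y = z from hy)]
    exact hc.continuousWithinAt
  · have hc : ContinuousAt (slitMap w q) z := by
      have h1 : ContinuousAt (fun y : ℂ => (y - w) / (y - q)) z :=
        ContinuousAt.div (by fun_prop) (by fun_prop) (sub_ne_zero.2 hzq)
      have hm := slit_mem' hz hzq
      have h2 : ContinuousAt (fun y : ℂ => ((y - w) / (y - q)) ^ ((2:ℂ)⁻¹)) z :=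
        ContinuousAt.comp (g := fun z : ℂ => z ^ ((2:ℂ)⁻¹)) (csqrt_continuousAt hm) h1
      have h3 := (h2.sub (continuousAt_const (y := Complex.I))).inv₀ (csqrt_ne_I hm)
      refine h3.congr ?_
      filter_upwards [isOpen_ne.mem_nhds hzq] with y hy
      rw [slitMap, if_neg hy]
      rfl
    exact hc.continuousWithinAt


/-! ### Doubling an arc -/

/-- All segments from `u` to points near `x` avoid `K`, except possibly at `u`. -/
def ConeAcc (K : Set ℂ) (u x : ℂ) : Prop :=
  ∃ ρ > 0, ∀ z ∈ Metric.ball x ρ, ∀ τ ∈ Set.Ioc (0:ℝ) 1, AffineMap.lineMap u z τ ∉ K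

lemma mem_seg_param {p q z : ℂ} (h : z ∈ segment ℝ p q) :
    ∃ s : ℝ, 0 ≤ s ∧ s ≤ 1 ∧ z.re = p.re + s * (q.re - p.re) ∧ z.im = p.im + s * (q.im - p.im) := by
  rw [segment_eq_image'] at h
  obtain ⟨s, hs, rfl⟩ := h
  exact ⟨s, hs.1, hs.2, by simp, by simp⟩

/-- The cross product of `p - w` and `q - w`. -/
noncomputable def crs (w p q : ℂ) : ℝ := (p.re - w.re) * (q.im - w.im) - (p.im - w.im) * (q.re - w.re)

/-- The configuration of two segments used for routing two parallel arcs. -/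
def GeoConf (w p₁ p₂ q : ℂ) : Prop :=
  p₂ ≠ q ∧ (∀ z ∈ segment ℝ p₂ q, z ∉ segment ℝ p₁ w) ∧
    (∀ z ∈ segment ℝ w q, z ∈ segment ℝ p₁ w → z = w) ∧
    (∀ z ∈ segment ℝ p₂ q, z ∈ segment ℝ w q → z = q)

lemma geo_aux {w p₁ p₂ c : ℂ} (h0 : crs w p₁ p₂ = 0) (hp : p₂ ∉ segment ℝ p₁ w)
    (hc : crs w p₁ c ≠ 0) (hc2 : crs w p₂ c ≠ 0) : GeoConf w p₁ p₂ c := by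
  unfold crs at *
  refine ⟨?_, ?_, ?_, ?_⟩
  · rintro rfl
    apply hc2; ring
  · intro z hz hz'
    obtain ⟨s, s0, s1, e1, e2⟩ := mem_seg_param hz
    obtain ⟨t, t0, t1, e3, e4⟩ := mem_seg_param hz'
    have : s * ((p₁.re - w.re) * (c.im - w.im) - (p₁.im - w.im) * (c.re - w.re)) = 0 := by
      rw [e1] at e3; rw [e2] at e4
      linear_combination (p₁.re - w.re) * e4 - (p₁.im - w.im) * e3 - (1 - s) * h0
    rcases mul_eq_zero.1 this with h | h
    · apply hp
      have : z = p₂ := Complex.ext (by rw [e1, h]; ring) (by rw [e2, h]; ring)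
      rwa [this] at hz'
    · exact hc h
  · intro z hz hz'
    obtain ⟨s, s0, s1, e1, e2⟩ := mem_seg_param hz
    obtain ⟨t, t0, t1, e3, e4⟩ := mem_seg_param hz'
    have : s * ((p₁.re - w.re) * (c.im - w.im) - (p₁.im - w.im) * (c.re - w.re)) = 0 := by
      rw [e1] at e3; rw [e2] at e4
      linear_combination (p₁.re - w.re) * e4 - (p₁.im - w.im) * e3
    rcases mul_eq_zero.1 this with h | h
    · exact Complex.ext (by rw [e1, h]; ring) (by rw [e2, h]; ring)
    · exact absurd h hc
  · intro z hz hz'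
    obtain ⟨s, s0, s1, e1, e2⟩ := mem_seg_param hz
    obtain ⟨t, t0, t1, e3, e4⟩ := mem_seg_param hz'
    have : (1 - s) * ((p₂.re - w.re) * (c.im - w.im) - (p₂.im - w.im) * (c.re - w.re)) = 0 := by
      rw [e1] at e3; rw [e2] at e4
      linear_combination (c.im - w.im) * e3 - (c.re - w.re) * e4
    rcases mul_eq_zero.1 this with h | h
    · have h' : s = 1 := by linarith
      exact Complex.ext (by rw [e1, h']; ring) (by rw [e2, h']; ring)
    · exact absurd h hc2

lemma geo_aux' {w p₁ p₂ : ℂ} (h0 : crs w p₁ p₂ ≠ 0) :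
    GeoConf w p₁ p₂ (midpoint ℝ p₂ w) := by
  have hq1 : (midpoint ℝ p₂ w).re = (p₂.re + w.re) / 2 := by
    simp [midpoint_eq_smul_add]; ring
  have hq2 : (midpoint ℝ p₂ w).im = (p₂.im + w.im) / 2 := by
    simp [midpoint_eq_smul_add]; ring
  have hne : p₂ ≠ w := by
    rintro rfl
    apply h0; unfold crs; ring
  unfold crs at *
  generalize midpoint ℝ p₂ w = q at *
  refine ⟨?_, ?_, ?_, ?_⟩
  · rintro rfl
    apply hne
    apply Complex.ext <;> linarith
  · intro z hz hz'
    obtain ⟨s, s0, s1, e1, e2⟩ := mem_seg_param hz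
    obtain ⟨t, t0, t1, e3, e4⟩ := mem_seg_param hz'
    rw [hq1] at e1; rw [hq2] at e2
    have : (1 - s / 2) * ((p₁.re - w.re) * (p₂.im - w.im) - (p₁.im - w.im) * (p₂.re - w.re)) = 0 := by
      rw [e1] at e3; rw [e2] at e4
      linear_combination (p₁.re - w.re) * e4 - (p₁.im - w.im) * e3
    rcases mul_eq_zero.1 this with h | h
    · linarith
    · exact h0 h
  · intro z hz hz'
    obtain ⟨s, s0, s1, e1, e2⟩ := mem_seg_param hz
    obtain ⟨t, t0, t1, e3, e4⟩ := mem_seg_param hz'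
    rw [hq1] at e1; rw [hq2] at e2
    have : (s / 2) * ((p₁.re - w.re) * (p₂.im - w.im) - (p₁.im - w.im) * (p₂.re - w.re)) = 0 := by
      rw [e1] at e3; rw [e2] at e4
      linear_combination (p₁.re - w.re) * e4 - (p₁.im - w.im) * e3
    rcases mul_eq_zero.1 this with h | h
    · have h' : s = 0 := by linarith
      exact Complex.ext (by rw [e1, h']; ring) (by rw [e2, h']; ring)
    · exact absurd h h0
  · intro z hz hz'
    obtain ⟨s, s0, s1, e1, e2⟩ := mem_seg_param hz
    obtain ⟨t, t0, t1, e3, e4⟩ := mem_seg_param hz'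
    rw [hq1] at e1 e3; rw [hq2] at e2 e4
    have h1 : (2 - s - t) * (p₂.re - w.re) = 0 := by
      rw [e1] at e3; linear_combination 2 * e3
    have h2 : (2 - s - t) * (p₂.im - w.im) = 0 := by
      rw [e2] at e4; linear_combination 2 * e4
    have h3 : 2 - s - t = 0 := by
      by_contra hne'
      apply hne
      rcases mul_eq_zero.1 h1 with h | h
      · exact absurd h hne'
      · rcases mul_eq_zero.1 h2 with h' | h'
        · exact absurd h' hne'
        · apply Complex.ext <;> linarith
    have h' : s = 1 := by linarith
    exact Complex.ext (by rw [e1, hq1, h']; ring) (by rw [e2, hq2, h']; ring)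

lemma geo {T : Set ℂ} (hT : Convex ℝ T) {w p₁ p₂ : ℂ} (hw : w ∈ T) (h₂ : p₂ ∈ T)
    (n₁ : p₁ ≠ w) (n₂ : p₂ ≠ w) (n₁₂ : p₁ ≠ p₂) (hc : ∀ p, p ≠ w → ∃ c ∈ T, crs w p c ≠ 0) :
    ∃ q ∈ T, q ≠ w ∧ (GeoConf w p₁ p₂ q ∨ GeoConf w p₂ p₁ q) := by
  by_cases h0 : crs w p₁ p₂ = 0
  · obtain ⟨c, hcT, hc1⟩ := hc p₁ n₁
    have hpar : ∃ l : ℝ, p₂.re - w.re = l * (p₁.re - w.re) ∧ p₂.im - w.im = l * (p₁.im - w.im) := by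
      unfold crs at h0
      by_cases hr : p₁.re - w.re = 0
      · have hi : p₁.im - w.im ≠ 0 := by
          intro hi
          apply n₁
          apply Complex.ext <;> linarith
        refine ⟨(p₂.im - w.im) / (p₁.im - w.im), ?_, by field_simp⟩
        rw [hr] at h0 ⊢
        have : (p₁.im - w.im) * (p₂.re - w.re) = 0 := by linarith
        rcases mul_eq_zero.1 this with h | h
        · exact absurd h hi
        · rw [h]; ring
      · refine ⟨(p₂.re - w.re) / (p₁.re - w.re), by field_simp, ?_⟩
        field_simp
        linarith
    obtain ⟨l, l1, l2⟩ := hpar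
    have hl0 : l ≠ 0 := by
      rintro rfl
      apply n₂
      apply Complex.ext <;> linarith
    have hc2 : crs w p₂ c ≠ 0 := by
      have : crs w p₂ c = l * crs w p₁ c := by
        unfold crs
        rw [l1, l2]; ring
      rw [this]
      exact mul_ne_zero hl0 hc1
    refine ⟨c, hcT, ?_, ?_⟩
    · rintro rfl
      apply hc1; unfold crs; ring
    · by_cases hp : p₂ ∈ segment ℝ p₁ w
      · right
        have h0' : crs w p₂ p₁ = 0 := by
          unfold crs at h0 ⊢; linarith
        refine geo_aux h0' ?_ hc2 hc1
        intro hp'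
        obtain ⟨s, s0, s1, e1, e2⟩ := mem_seg_param hp
        obtain ⟨t, t0, t1, e3, e4⟩ := mem_seg_param hp'
        rcases eq_or_lt_of_le s0 with h | h
        · apply n₁₂
          rw [← h] at e1 e2
          apply Complex.ext <;> linarith
        · apply n₁
          have f1 : (s + t * (1 - s)) * (p₁.re - w.re) = 0 := by
            rw [e1] at e3
            linear_combination e3
          have f2 : (s + t * (1 - s)) * (p₁.im - w.im) = 0 := by
            rw [e2] at e4
            linear_combination e4
          have hpos : s + t * (1 - s) ≠ 0 := by
            have : 0 ≤ t * (1 - s) := mul_nonneg t0 (by linarith)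
            linarith
          apply Complex.ext
          · rcases mul_eq_zero.1 f1 with h | h
            · exact absurd h hpos
            · linarith
          · rcases mul_eq_zero.1 f2 with h | h
            · exact absurd h hpos
            · linarith
      · left; exact geo_aux h0 hp hc1 hc2
  · refine ⟨midpoint ℝ p₂ w, hT.midpoint_mem h₂ hw, ?_, Or.inl (geo_aux' h0)⟩
    simpa using n₂

/-- First hitting of a closed set along a path. -/
lemma first_hit {φ : ℝ → ℂ} (hφ : Continuous φ) {T : Set ℂ} (hT : IsClosed T) (h0 : φ 0 ∉ T)
    (h1 : φ 1 ∈ T) : ∃ t, 0 < t ∧ t ≤ 1 ∧ φ t ∈ T ∧ ∀ s ∈ Set.Icc 0 t, φ s ∈ T → s = t := by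
  have hS : IsCompact (Set.Icc (0:ℝ) 1 ∩ φ ⁻¹' T) := isCompact_Icc.inter_right (hT.preimage hφ)
  obtain ⟨t, ht, htm⟩ := hS.exists_isLeast ⟨1, by simp, h1⟩
  refine ⟨t, lt_of_le_of_ne ht.1.1 (fun h => h0 (by rw [h]; exact ht.2)), ht.1.2, ht.2, ?_⟩
  intro s hs hsT
  exact le_antisymm hs.2 (htm ⟨⟨hs.1, hs.2.trans ht.1.2⟩, hsT⟩)

lemma double_aux {K T P₁ P₂ : Set ℂ} {u w p₁ p₂ q : ℂ} (hT : Convex ℝ T) (hwT : w ∈ T)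
    (hTK : ∀ z ∈ T, z ∈ K → z = w) (h₁ : p₁ ∈ T) (h₂ : p₂ ∈ T) (n₁ : p₁ ≠ w)
    (hq : q ∈ T) (hqw : q ≠ w) (hP₁ : IsArcC P₁ u p₁) (hP₂ : IsArcC P₂ u p₂)
    (hT₁ : ∀ z ∈ P₁, z ∈ T → z = p₁) (hT₂ : ∀ z ∈ P₂, z ∈ T → z = p₂)
    (hK₁ : ∀ z ∈ P₁, z ∈ K → z = u) (hK₂ : ∀ z ∈ P₂, z ∈ K → z = u)
    (hP : ∀ z ∈ P₁, z ∈ P₂ → z = u) (hG : GeoConf w p₁ p₂ q) :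
    ∃ (E F : Set ℂ) (q : ℂ), IsArcC E u w ∧ IsArcC F u q ∧ q ≠ w ∧
      (∀ z ∈ E, z ∈ K → z = u ∨ z = w) ∧ (∀ z ∈ F, z ∈ K → z = u) ∧ (∀ z ∈ E, z ∈ F → z = u) ∧
      (∀ z ∈ openSegment ℝ w q, z ∉ K ∧ z ∉ E ∧ z ∉ F) := by
  obtain ⟨g0, g1, g2, g3⟩ := hG
  have s1 : segment ℝ p₁ w ⊆ T := hT.segment_subset h₁ hwT
  have s2 : segment ℝ p₂ q ⊆ T := hT.segment_subset h₂ hq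
  have s3 : segment ℝ w q ⊆ T := hT.segment_subset hwT hq
  refine ⟨P₁ ∪ segment ℝ p₁ w, P₂ ∪ segment ℝ p₂ q, q, hP₁.trans (isArcC_segment n₁) ?_,
    hP₂.trans (isArcC_segment g0) ?_, hqw, ?_, ?_, ?_, ?_⟩
  · exact fun z hz hz' => hT₁ z hz (s1 hz')
  · exact fun z hz hz' => hT₂ z hz (s2 hz')
  · rintro z (hz | hz) hzK
    · exact Or.inl (hK₁ z hz hzK)
    · exact Or.inr (hTK z (s1 hz) hzK)
  · rintro z (hz | hz) hzK
    · exact hK₂ z hz hzK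
    · have := hTK z (s2 hz) hzK
      subst this
      exact absurd (right_mem_segment ℝ p₁ z) (g1 _ hz)
  · rintro z (hz | hz) (hz' | hz')
    · exact hP z hz hz'
    · have := hT₁ z hz (s2 hz')
      subst this
      exact absurd (left_mem_segment ℝ z w) (g1 _ hz')
    · have := hT₂ z hz' (s1 hz)
      subst this
      exact absurd hz (g1 _ (left_mem_segment ℝ z q))
    · exact absurd hz (g1 _ hz')
  · intro z hz
    have hzs := openSegment_subset_segment ℝ w q hz
    have hzw : z ≠ w := by
      rintro rfl
      exact hqw ((left_mem_openSegment_iff).1 hz).symm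
    have hzq : z ≠ q := by
      rintro rfl
      exact hqw ((right_mem_openSegment_iff).1 hz).symm
    refine ⟨fun hzK => hzw (hTK z (s3 hzs) hzK), ?_, ?_⟩
    · rintro (h | h)
      · have := hT₁ z h (s3 hzs)
        subst this
        exact hzw (g2 z hzs (left_mem_segment ℝ z w))
      · exact hzw (g2 z hzs h)
    · rintro (h | h)
      · have := hT₂ z h (s3 hzs)
        subst this
        exact hzq (g3 z (left_mem_segment ℝ z q) hzs)
      · exact hzq (g3 z h hzs)

lemma double {K : Set ℂ} (hK : IsClosed K) {u w x y : ℂ} (huw : u ≠ w) (hu : u ∈ K) (hw : w ∈ K)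
    (hx : ConeAcc K u x) (hy : ConeAcc K w y) {C : Set ℂ} (hC : IsPreconnected C)
    (hCK : C ⊆ Kᶜ) (hxC : x ∈ C) (hyC : y ∈ C) :
    ∃ (E F : Set ℂ) (q : ℂ), IsArcC E u w ∧ IsArcC F u q ∧ q ≠ w ∧
      (∀ z ∈ E, z ∈ K → z = u ∨ z = w) ∧ (∀ z ∈ F, z ∈ K → z = u) ∧ (∀ z ∈ E, z ∈ F → z = u) ∧
      (∀ z ∈ openSegment ℝ w q, z ∉ K ∧ z ∉ E ∧ z ∉ F) := by
  obtain ⟨h, hxy, hid⟩ := homog hK.isOpen_compl hC hCK hxC hyC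
  have hidK : ∀ z ∈ K, h z = z := fun z hz => hid z (by simpa using hz)
  have hKinv : ∀ z, h z ∈ K → z ∈ K := by
    intro z hz
    have := hidK _ hz
    have := h.injective this
    rwa [this] at hz
  obtain ⟨ρ, hρ, hcx⟩ := hx
  obtain ⟨ρ', hρ', hcy⟩ := hy
  -- the cone at `w`
  set T : Set ℂ := convexHull ℝ (insert w (Metric.closedBall y (ρ' / 2))) with hTdef
  have hTc : Convex ℝ T := convex_convexHull _ _
  have hwT : w ∈ T := subset_convexHull _ _ (by simp)
  have hbT : Metric.closedBall y (ρ' / 2) ⊆ T := fun z hz => subset_convexHull _ _ (by simp [hz])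
  have hTmem : ∀ z ∈ T, ∃ b ∈ Metric.closedBall y (ρ' / 2), ∃ τ ∈ Set.Icc (0:ℝ) 1,
      AffineMap.lineMap w b τ = z := by
    intro z hz
    rw [hTdef, convexHull_insert ⟨y, by simp; positivity⟩,
      (convex_closedBall _ _).convexHull_eq, mem_convexJoin] at hz
    obtain ⟨a, ha, b, hb, hz⟩ := hz
    rw [Set.mem_singleton_iff] at ha
    subst ha
    rw [segment_eq_image_lineMap] at hz
    obtain ⟨τ, hτ, rfl⟩ := hz
    exact ⟨b, hb, τ, hτ, rfl⟩
  have hTcl : IsClosed T := by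
    have : T = (fun p : ℂ × ℝ => AffineMap.lineMap w p.1 p.2) ''
        (Metric.closedBall y (ρ' / 2) ×ˢ Set.Icc (0:ℝ) 1) := by
      ext z
      constructor
      · intro hz
        obtain ⟨b, hb, τ, hτ, rfl⟩ := hTmem z hz
        exact ⟨(b, τ), ⟨hb, hτ⟩, rfl⟩
      · rintro ⟨⟨b, τ⟩, ⟨hb, hτ⟩, rfl⟩
        exact hTc.lineMap_mem hwT (hbT hb) hτ
    rw [this]
    apply IsCompact.isClosed
    apply IsCompact.image
    · exact (isCompact_closedBall _ _).prod isCompact_Icc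
    · simp only [AffineMap.lineMap_apply, vsub_eq_sub, vadd_eq_add]
      fun_prop
  have hTK : ∀ z ∈ T, z ∈ K → z = w := by
    intro z hz hzK
    obtain ⟨b, hb, τ, hτ, rfl⟩ := hTmem z hz
    rcases eq_or_lt_of_le hτ.1 with h0 | h0
    · rw [← h0]; simp
    · exact absurd hzK (hcy b (Metric.closedBall_subset_ball (by linarith) hb) τ ⟨h0, hτ.2⟩)
  have huT : u ∉ T := fun h => huw (hTK u h hu)
  -- two rays from `u`
  have hnb : h ⁻¹' Metric.ball y (ρ' / 2) ∈ nhds x := by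
    apply h.continuous.continuousAt.preimage_mem_nhds
    rw [hxy]
    exact Metric.ball_mem_nhds y (half_pos hρ')
  obtain ⟨ρ₁, hρ₁, hball⟩ := Metric.mem_nhds_iff.1 hnb
  have hxu : x ≠ u := by
    rintro rfl
    exact hCK hxC hu
  have hxu0 : 0 < ‖x - u‖ := norm_pos_iff.2 (sub_ne_zero.2 hxu)
  set ε : ℝ := min ρ ρ₁ / (2 * ‖x - u‖) with hε
  have hmin : 0 < min ρ ρ₁ := lt_min hρ hρ₁
  have hε0 : 0 < ε := by positivity
  set x₂ : ℂ := x + ε * Complex.I * (x - u) with hx₂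
  have hx₂d : dist x₂ x < min ρ ρ₁ := by
    rw [dist_eq_norm, hx₂, add_sub_cancel_left, norm_mul, norm_mul, Complex.norm_I,
      Complex.norm_real, Real.norm_eq_abs, abs_of_pos hε0, mul_one, hε]
    field_simp
    linarith
  have key : ∀ z : ℂ, Dist.dist z x < min ρ ρ₁ → ∃ t : ℝ, 0 < t ∧ t ≤ 1 ∧
      h (AffineMap.lineMap u z t) ∈ T ∧ h (AffineMap.lineMap u z t) ≠ w ∧
      IsArcC ((fun s : ℝ => h (AffineMap.lineMap u z s)) '' Set.Icc 0 t) u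
        (h (AffineMap.lineMap u z t)) ∧
      (∀ a ∈ (fun s : ℝ => h (AffineMap.lineMap u z s)) '' Set.Icc 0 t, a ∈ T →
        a = h (AffineMap.lineMap u z t)) ∧
      (∀ a ∈ (fun s : ℝ => h (AffineMap.lineMap u z s)) '' Set.Icc 0 t, a ∈ K → a = u) := by
    intro z hz
    have hz1 : z ∈ Metric.ball x ρ := lt_of_lt_of_le hz (min_le_left _ _)
    have hz2 : z ∈ Metric.ball x ρ₁ := lt_of_lt_of_le hz (min_le_right _ _)
    have hcont : Continuous (fun s : ℝ => h (AffineMap.lineMap u z s)) :=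
      h.continuous.comp AffineMap.lineMap_continuous
    have hzK : ∀ s ∈ Set.Ioc (0:ℝ) 1, h (AffineMap.lineMap u z s) ∉ K :=
      fun s hs hh => hcx z hz1 s hs (hKinv _ hh)
    have hzu : u ≠ z := by
      rintro rfl
      exact hcx u hz1 1 (by simp) (by simpa using hu)
    obtain ⟨t, t0, t1, htT, htm⟩ := first_hit hcont hTcl
      (by simp only [AffineMap.lineMap_apply_zero]; rw [hidK u hu]; exact huT)
      (by simp only [AffineMap.lineMap_apply_one]
          exact hbT (Metric.ball_subset_closedBall (hball hz2)))
    refine ⟨t, t0, t1, htT, ?_, ?_, ?_, ?_⟩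
    · intro he
      exact hzK t ⟨t0, t1⟩ (by rw [he]; exact hw)
    · have := isArcC_of_param t0 hcont.continuousOn
        ((h.injective.comp (AffineMap.lineMap_injective ℝ hzu)).injOn (s := Set.Icc 0 t))
      simp only [AffineMap.lineMap_apply_zero] at this
      rwa [hidK u hu] at this
    · rintro a ⟨s, hs, rfl⟩ ha
      rw [htm s hs ha]
    · rintro a ⟨s, hs, rfl⟩ ha
      rcases eq_or_lt_of_le hs.1 with h0 | h0
      · rw [← h0]; simp [hidK u hu]
      · exact absurd ha (hzK s ⟨h0, hs.2.trans t1⟩)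
  obtain ⟨t₁, a0, a1, aT, aw, aArc, aT', aK⟩ := key x (by simpa using hmin)
  obtain ⟨t₂, b0, b1, bT, bw, bArc, bT', bK⟩ := key x₂ hx₂d
  have hray : ∀ s t : ℝ, (AffineMap.lineMap u x s : ℂ) = AffineMap.lineMap u x₂ t → t = 0 := by
    intro s t hst
    simp only [AffineMap.lineMap_apply, vsub_eq_sub, vadd_eq_add, Complex.real_smul] at hst
    have h1 : ((s : ℂ) - t - t * ε * Complex.I) * (x - u) = 0 := by
      rw [hx₂] at hst
      linear_combination hst
    rcases mul_eq_zero.1 h1 with h2 | h2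
    · have h3 := congrArg Complex.im h2
      simp at h3
      rcases h3 with h3 | h3
      · exact h3
      · exact absurd h3 hε0.ne'
    · exact absurd (sub_eq_zero.1 h2) hxu
  have hPP : ∀ z ∈ (fun s : ℝ => h (AffineMap.lineMap u x s)) '' Set.Icc 0 t₁,
      z ∈ (fun s : ℝ => h (AffineMap.lineMap u x₂ s)) '' Set.Icc 0 t₂ → z = u := by
    rintro z ⟨s, hs, rfl⟩ ⟨t, ht, hst⟩
    have := hray s t (h.injective hst.symm)
    subst this
    rw [← hst]; simp [hidK u hu]
  have hne : h (AffineMap.lineMap u x t₁) ≠ h (AffineMap.lineMap u x₂ t₂) := by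
    intro he
    exact b0.ne' (hray t₁ t₂ (h.injective he))
  have hcr : ∀ p, p ≠ w → ∃ c ∈ T, crs w p c ≠ 0 := by
    intro p hp
    by_contra hall
    push Not at hall
    have hyT : ∀ d : ℂ, ‖d‖ ≤ ρ' / 2 → y + d ∈ T := fun d hd => hbT (by simpa using hd)
    have c0 := hall _ (hyT 0 (by simp; positivity))
    have c1 := hall _ (hyT ((ρ' / 2 : ℝ) : ℂ) (by
      rw [Complex.norm_real, Real.norm_eq_abs, abs_of_pos (half_pos hρ')]))
    have c2 := hall _ (hyT (((ρ' / 2 : ℝ) : ℂ) * Complex.I) (by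
      rw [norm_mul, Complex.norm_I, Complex.norm_real, Real.norm_eq_abs,
        abs_of_pos (half_pos hρ')]; simp))
    unfold crs at c0 c1 c2
    simp only [Complex.add_re, Complex.add_im, Complex.ofReal_re, Complex.ofReal_im,
      Complex.mul_re, Complex.mul_im, Complex.I_re, Complex.I_im, Complex.zero_re,
      Complex.zero_im] at c0 c1 c2
    have d1 : (p.im - w.im) * (ρ' / 2) = 0 := by linear_combination c0 - c1
    have d2 : (p.re - w.re) * (ρ' / 2) = 0 := by linear_combination c2 - c0
    have hne' : ρ' / 2 ≠ 0 := (half_pos hρ').ne'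
    apply hp
    apply Complex.ext
    · have := (mul_eq_zero.1 d2).resolve_right hne'
      linarith
    · have := (mul_eq_zero.1 d1).resolve_right hne'
      linarith
  obtain ⟨q, hqT, hqw, hG | hG⟩ := geo hTc hwT bT aw bw hne hcr
  · exact double_aux hTc hwT hTK aT bT aw hqT hqw aArc bArc aT' bT' aK bK hPP hG
  · exact double_aux hTc hwT hTK bT aT bw hqT hqw bArc aArc bT' aT' bK aK
      (fun z h1 h2 => hPP z h2 h1) hG


/-! ### Drawings in the complex plane -/

/-- A planar drawing of the graph with vertex set `A` and edge set `E`. -/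
structure Drw {V : Type*} (E : Set (Sym2 V)) (A : Set V) (pos : V → ℂ) (arc : Sym2 V → Set ℂ) :
    Prop where
  sub : ∀ e ∈ E, ∀ x ∈ e, x ∈ A
  inj : Set.InjOn pos A
  isArc : ∀ u v, s(u, v) ∈ E → IsArcC (arc s(u, v)) (pos u) (pos v)
  inter : ∀ e₁ ∈ E, ∀ e₂ ∈ E, e₁ ≠ e₂ → ∀ z ∈ arc e₁, z ∈ arc e₂ →
    ∃ v, v ∈ e₁ ∧ v ∈ e₂ ∧ z = pos v
  posarc : ∀ e ∈ E, ∀ v ∈ A, pos v ∈ arc e → v ∈ e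

/-- The points used by a drawing. -/
def dimg {V : Type*} (E : Set (Sym2 V)) (A : Set V) (pos : V → ℂ) (arc : Sym2 V → Set ℂ) : Set ℂ :=
  pos '' A ∪ ⋃ e ∈ E, arc e

section
variable {V : Type*} {E E' : Set (Sym2 V)} {A A' : Set V} {pos : V → ℂ} {arc : Sym2 V → Set ℂ}

lemma mem_dimg {z : ℂ} : z ∈ dimg E A pos arc ↔ (∃ x ∈ A, pos x = z) ∨ ∃ e ∈ E, z ∈ arc e := by
  simp [dimg]

lemma pos_mem_dimg {x : V} (hx : x ∈ A) : pos x ∈ dimg E A pos arc :=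
  mem_dimg.2 (Or.inl ⟨x, hx, rfl⟩)

lemma arc_mem_dimg {e : Sym2 V} (he : e ∈ E) {z : ℂ} (hz : z ∈ arc e) : z ∈ dimg E A pos arc :=
  mem_dimg.2 (Or.inr ⟨e, he, hz⟩)

lemma Drw.mono (h : Drw E A pos arc) (hE : E' ⊆ E) (hA : A' ⊆ A)
    (hs : ∀ e ∈ E', ∀ x ∈ e, x ∈ A') : Drw E' A' pos arc where
  sub := hs
  inj := h.inj.mono hA
  isArc u v huv := h.isArc u v (hE huv)
  inter e₁ h₁ e₂ h₂ := h.inter e₁ (hE h₁) e₂ (hE h₂)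
  posarc e he v hv := h.posarc e (hE he) v (hA hv)

lemma Drw.map (h : Drw E A pos arc) {φ : ℂ → ℂ} {M : Set ℂ} (hM : dimg E A pos arc ⊆ M)
    (hc : ContinuousOn φ M) (hi : Set.InjOn φ M) :
    Drw E A (fun x => φ (pos x)) (fun e => φ '' arc e) where
  sub := h.sub
  inj x hx y hy hxy := h.inj hx hy (hi (hM (pos_mem_dimg hx)) (hM (pos_mem_dimg hy)) hxy)
  isArc u v huv := by
    have hs : arc s(u, v) ⊆ M := fun z hz => hM (arc_mem_dimg huv hz)
    exact (h.isArc u v huv).image (hc.mono hs) (hi.mono hs)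
  inter := by
    rintro e₁ h₁ e₂ h₂ hne z ⟨a, ha, rfl⟩ ⟨b, hb, hab⟩
    have : b = a := hi (hM (arc_mem_dimg h₂ hb)) (hM (arc_mem_dimg h₁ ha)) hab
    subst this
    obtain ⟨v, hv1, hv2, rfl⟩ := h.inter e₁ h₁ e₂ h₂ hne b ha hb
    exact ⟨v, hv1, hv2, rfl⟩
  posarc := by
    rintro e he v hv ⟨a, ha, hav⟩
    have : a = pos v := hi (hM (arc_mem_dimg he ha)) (hM (pos_mem_dimg hv)) hav
    subst this
    exact h.posarc e he v hv ha

lemma dimg_map {φ : ℂ → ℂ} : dimg E A (fun x => φ (pos x)) (fun e => φ '' arc e) =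
    φ '' dimg E A pos arc := by
  ext z
  simp only [mem_dimg, Set.mem_image]
  constructor
  · rintro (⟨x, hx, rfl⟩ | ⟨e, he, a, ha, rfl⟩)
    · exact ⟨_, Or.inl ⟨x, hx, rfl⟩, rfl⟩
    · exact ⟨a, Or.inr ⟨e, he, ha⟩, rfl⟩
  · rintro ⟨a, ⟨x, hx, rfl⟩ | ⟨e, he, ha⟩, rfl⟩
    · exact Or.inl ⟨x, hx, rfl⟩
    · exact Or.inr ⟨e, he, a, ha, rfl⟩

lemma Drw.arc_compact (h : Drw E A pos arc) {e : Sym2 V} (he : e ∈ E) : IsCompact (arc e) := by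
  induction e using Sym2.ind with
  | _ u v => exact (h.isArc u v he).isCompact

lemma Drw.pos_mem_arc (h : Drw E A pos arc) {e : Sym2 V} (he : e ∈ E) {x : V} (hx : x ∈ e) :
    pos x ∈ arc e := by
  induction e using Sym2.ind with
  | _ u v =>
    rcases Sym2.mem_iff.1 hx with rfl | rfl
    · exact (h.isArc _ _ he).left_mem
    · exact (h.isArc _ _ he).right_mem

lemma Drw.compact [Finite V] (h : Drw E A pos arc) : IsCompact (dimg E A pos arc) := by
  apply IsCompact.union
  · exact (Set.toFinite _).isCompact
  · exact (Set.toFinite E).isCompact_biUnion (fun e he => h.arc_compact he)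

open Classical in
/-- Adding an arc to a drawing. -/
lemma Drw.addArc (h : Drw E A pos arc) {u v : V} (hu : u ∈ A) (hv : v ∈ A) (hn : s(u, v) ∉ E)
    {F : Set ℂ} (hF : IsArcC F (pos u) (pos v))
    (hFi : ∀ z ∈ F, z ∈ dimg E A pos arc → z = pos u ∨ z = pos v) :
    Drw (insert s(u, v) E) A pos (fun e => if e = s(u, v) then F else arc e) := by
  have hne : ∀ e ∈ E, e ≠ s(u, v) := by
    rintro e he rfl; exact hn he
  have key : ∀ e ∈ E, ∀ z ∈ F, z ∈ arc e → ∃ x, x ∈ s(u, v) ∧ x ∈ e ∧ z = pos x := by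
    intro e he z hz hze
    rcases hFi z hz (arc_mem_dimg he hze) with rfl | rfl
    · exact ⟨u, by simp, h.posarc e he u hu hze, rfl⟩
    · exact ⟨v, by simp, h.posarc e he v hv hze, rfl⟩
  refine ⟨?_, h.inj, ?_, ?_, ?_⟩
  · rintro e (rfl | he) x hx
    · rcases Sym2.mem_iff.1 hx with rfl | rfl <;> assumption
    · exact h.sub e he x hx
  · rintro a b (hab | hab)
    · simp only [hab, if_true]
      rw [Sym2.eq_iff] at hab
      rcases hab with ⟨rfl, rfl⟩ | ⟨rfl, rfl⟩
      · exact hF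
      · exact hF.symm
    · simp only [hne _ hab, if_false]
      exact h.isArc a b hab
  · rintro e₁ (rfl | h₁) e₂ (rfl | h₂) h12 z hz1 hz2
    · exact absurd rfl h12
    · simp only [if_true] at hz1
      simp only [hne _ h₂, if_false] at hz2
      exact key e₂ h₂ z hz1 hz2
    · simp only [if_true] at hz2
      simp only [hne _ h₁, if_false] at hz1
      obtain ⟨x, a, b, c⟩ := key e₁ h₁ z hz2 hz1
      exact ⟨x, b, a, c⟩
    · simp only [hne _ h₁, if_false] at hz1
      simp only [hne _ h₂, if_false] at hz2
      exact h.inter e₁ h₁ e₂ h₂ h12 z hz1 hz2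
  · rintro e (rfl | he) x hx hxa
    · simp only [if_true] at hxa
      rcases hFi _ hxa (pos_mem_dimg hx) with h' | h'
      · rw [h.inj hx hu h']; simp
      · rw [h.inj hx hv h']; simp
    · simp only [hne _ he, if_false] at hxa
      exact h.posarc e he x hx hxa

lemma seg_sphere_inter {p x y z : ℂ} {r : ℝ} (hr : 0 < r) (hx : Dist.dist x p = r)
    (hy : Dist.dist y p = r) (hxy : x ≠ y) (h1 : z ∈ segment ℝ p x) (h2 : z ∈ segment ℝ p y) :
    z = p := by
  rw [segment_eq_image'] at h1 h2
  obtain ⟨s, hs, rfl⟩ := h1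
  obtain ⟨t, ht, hst⟩ := h2
  simp only [add_right_inj] at hst
  have hn := congrArg norm hst
  rw [norm_smul, norm_smul, ← dist_eq_norm, ← dist_eq_norm, hx, hy, Real.norm_eq_abs,
    Real.norm_eq_abs, abs_of_nonneg hs.1, abs_of_nonneg ht.1] at hn
  have hts : t = s := mul_right_cancel₀ hr.ne' hn
  subst hts
  by_cases h0 : t = 0
  · simp [h0]
  · have := smul_right_injective ℂ h0 hst
    exact absurd (by simpa using this.symm) hxy

/-- Making the arcs at a vertex straight near this vertex. -/
lemma Drw.radialize [Finite V] (h : Drw E A pos arc) {v : V} (hv : v ∈ A) {r₀ : ℝ} (hr₀ : 0 < r₀) :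
    ∃ (r : ℝ) (arc' : Sym2 V → Set ℂ) (xs : Sym2 V → ℂ), 0 < r ∧ r ≤ r₀ ∧ Drw E A pos arc' ∧
      (∀ e ∈ E, arc' e ⊆ arc e ∪ Metric.closedBall (pos v) r) ∧
      (∀ x ∈ A, pos x ∈ Metric.closedBall (pos v) r → x = v) ∧
      (∀ e ∈ E, v ∉ e → ∀ z ∈ arc' e, z ∉ Metric.closedBall (pos v) r) ∧
      (∀ e ∈ E, v ∈ e → Dist.dist (xs e) (pos v) = r ∧
        ∀ z ∈ arc' e, z ∈ Metric.closedBall (pos v) r → z ∈ segment ℝ (pos v) (xs e)) ∧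
      (∀ e ∈ E, ∀ e' ∈ E, v ∈ e → v ∈ e' → e ≠ e' → xs e ≠ xs e') := by
  classical
  set K : Set ℂ := pos '' (A \ {v}) ∪ ⋃ e ∈ {e ∈ E | v ∉ e}, arc e with hK
  have hKc : IsClosed K := by
    apply IsCompact.isClosed
    apply IsCompact.union
    · exact (Set.toFinite _).isCompact
    · exact (Set.toFinite _).isCompact_biUnion (fun e he => h.arc_compact he.1)
  have hvK : pos v ∉ K := by
    rintro (⟨x, hx, hxv⟩ | hmem)
    · exact hx.2 (h.inj hx.1 hv hxv)
    · simp only [Set.mem_iUnion] at hmem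
      obtain ⟨e, he, hz⟩ := hmem
      exact he.2 (h.posarc e he.1 v hv hz)
  obtain ⟨r₁, hr₁, hball⟩ := Metric.isOpen_iff.1 hKc.isOpen_compl (pos v) hvK
  set r := min r₀ (r₁ / 2) with hr
  have hr0 : 0 < r := lt_min hr₀ (half_pos hr₁)
  have hcb : ∀ z ∈ Metric.closedBall (pos v) r, z ∉ K := by
    intro z hz
    apply hball
    exact Metric.closedBall_subset_ball (lt_of_le_of_lt (min_le_right _ _) (by linarith)) hz
  have hpos : ∀ x ∈ A, pos x ∈ Metric.closedBall (pos v) r → x = v := by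
    intro x hx hmem
    by_contra hne
    exact hcb _ hmem (Or.inl ⟨x, ⟨hx, hne⟩, rfl⟩)
  have hoth : ∀ e ∈ E, v ∉ e → ∀ z ∈ arc e, z ∉ Metric.closedBall (pos v) r := by
    intro e he hve z hz hmem
    apply hcb z hmem
    right
    simp only [Set.mem_iUnion]
    exact ⟨e, ⟨he, hve⟩, hz⟩
  have hstr : ∀ e : Sym2 V, ∃ (x : ℂ) (B : Set ℂ), e ∈ E → v ∈ e →
      Dist.dist x (pos v) = r ∧ x ∈ arc e ∧ (∀ y, e = s(v, y) → IsArcC B (pos v) (pos y)) ∧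
      B ⊆ arc e ∪ segment ℝ (pos v) x ∧
      B ∩ Metric.closedBall (pos v) r ⊆ segment ℝ (pos v) x ∧ segment ℝ (pos v) x ⊆ B := by
    intro e
    by_cases hc : e ∈ E ∧ v ∈ e
    · obtain ⟨he, hve⟩ := hc
      obtain ⟨y, rfl⟩ := hve
      have harc := h.isArc v y he
      have hy : pos y ∉ Metric.closedBall (pos v) r := by
        intro hmem
        have := hpos y (h.sub _ he y (by simp)) hmem
        subst this
        exact harc.ne rfl
      obtain ⟨x, B, h1, h2, h3, h4, h5, h6⟩ := harc.straighten hr0 hy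
      refine ⟨x, B, fun _ _ => ⟨h1, h2, ?_, h4, h5, h6⟩⟩
      intro y' hy'
      have : y = y' := by
        rcases (by simpa using hy' : y = y' ∨ v = y' ∧ y = v) with h' | ⟨h1, h2⟩
        exacts [h', h2.trans h1]
      subst this
      exact h3
    · exact ⟨0, ∅, fun h1 h2 => absurd ⟨h1, h2⟩ hc⟩
  choose xs B hxB using hstr
  have hsegball : ∀ e ∈ E, v ∈ e → segment ℝ (pos v) (xs e) ⊆ Metric.closedBall (pos v) r := by
    intro e he hve
    apply (convex_closedBall _ _).segment_subset (by simp [hr0.le])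
    rw [Metric.mem_closedBall, (hxB e he hve).1]
  have hxne : ∀ e ∈ E, ∀ e' ∈ E, v ∈ e → v ∈ e' → e ≠ e' → xs e ≠ xs e' := by
    intro e he e' he' hve hve' hne hxx
    have m1 := (hxB e he hve).2.1
    have m2 := (hxB e' he' hve').2.1
    rw [← hxx] at m2
    obtain ⟨x, hx1, hx2, hx3⟩ := h.inter e he e' he' hne _ m1 m2
    have hd := (hxB e he hve).1
    have : x = v := hpos x (h.sub e he x hx1) (by rw [Metric.mem_closedBall, ← hx3, hd])
    subst this
    rw [hx3, _root_.dist_self] at hd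
    exact hr0.ne hd
  have hBout : ∀ e ∈ E, v ∈ e → ∀ z ∈ B e, z ∉ Metric.closedBall (pos v) r → z ∈ arc e := by
    intro e he hve z hz hzn
    rcases (hxB e he hve).2.2.2.1 hz with h1 | h1
    · exact h1
    · exact absurd (hsegball e he hve h1) hzn
  let arc' : Sym2 V → Set ℂ := fun e => if v ∈ e then B e else arc e
  have ha1 : ∀ e, v ∈ e → arc' e = B e := fun e he => by simp [arc', he]
  have ha2 : ∀ e, v ∉ e → arc' e = arc e := fun e he => by simp [arc', he]
  have hmix : ∀ e₁ ∈ E, ∀ e₂ ∈ E, v ∈ e₁ → v ∉ e₂ → e₁ ≠ e₂ → ∀ z ∈ B e₁, z ∈ arc e₂ →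
      ∃ x, x ∈ e₁ ∧ x ∈ e₂ ∧ z = pos x := by
    intro e₁ h₁ e₂ h₂ v1 v2 hne z hz1 hz2
    exact h.inter e₁ h₁ e₂ h₂ hne z (hBout e₁ h₁ v1 z hz1 (hoth e₂ h₂ v2 z hz2)) hz2
  refine ⟨r, arc', xs, hr0, min_le_left _ _, ⟨h.sub, h.inj, ?_, ?_, ?_⟩, ?_, hpos, ?_, ?_, hxne⟩
  · intro a b hab
    by_cases hve : v ∈ s(a, b)
    · rw [ha1 _ hve]
      have := (hxB _ hab hve).2.2.1
      rcases Sym2.mem_iff.1 hve with rfl | rfl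
      · exact this b rfl
      · exact (this a Sym2.eq_swap).symm
    · rw [ha2 _ hve]; exact h.isArc a b hab
  · intro e₁ h₁ e₂ h₂ hne z hz1 hz2
    by_cases v1 : v ∈ e₁ <;> by_cases v2 : v ∈ e₂
    · rw [ha1 _ v1] at hz1
      rw [ha1 _ v2] at hz2
      by_cases hzb : z ∈ Metric.closedBall (pos v) r
      · refine ⟨v, v1, v2, ?_⟩
        exact seg_sphere_inter hr0 (hxB e₁ h₁ v1).1 (hxB e₂ h₂ v2).1 (hxne e₁ h₁ e₂ h₂ v1 v2 hne)
          ((hxB e₁ h₁ v1).2.2.2.2.1 ⟨hz1, hzb⟩) ((hxB e₂ h₂ v2).2.2.2.2.1 ⟨hz2, hzb⟩)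
      · exact h.inter e₁ h₁ e₂ h₂ hne z (hBout e₁ h₁ v1 z hz1 hzb) (hBout e₂ h₂ v2 z hz2 hzb)
    · rw [ha1 _ v1] at hz1
      rw [ha2 _ v2] at hz2
      exact hmix e₁ h₁ e₂ h₂ v1 v2 hne z hz1 hz2
    · rw [ha2 _ v1] at hz1
      rw [ha1 _ v2] at hz2
      obtain ⟨x, a, b, c⟩ := hmix e₂ h₂ e₁ h₁ v2 v1 hne.symm z hz2 hz1
      exact ⟨x, b, a, c⟩
    · rw [ha2 _ v1] at hz1
      rw [ha2 _ v2] at hz2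
      exact h.inter e₁ h₁ e₂ h₂ hne z hz1 hz2
  · intro e he x hx hxa
    by_cases hve : v ∈ e
    · rw [ha1 _ hve] at hxa
      by_cases hzb : pos x ∈ Metric.closedBall (pos v) r
      · rw [hpos x hx hzb]; exact hve
      · exact h.posarc e he x hx (hBout e he hve _ hxa hzb)
    · rw [ha2 _ hve] at hxa
      exact h.posarc e he x hx hxa
  · intro e he z hz
    by_cases hve : v ∈ e
    · rw [ha1 _ hve] at hz
      rcases (hxB e he hve).2.2.2.1 hz with h1 | h1
      · exact Or.inl h1
      · exact Or.inr (hsegball e he hve h1)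
    · rw [ha2 _ hve] at hz
      exact Or.inl hz
  · intro e he hve z hz
    rw [ha2 _ hve] at hz
    exact hoth e he hve z hz
  · intro e he hve
    refine ⟨(hxB e he hve).1, ?_⟩
    intro z hz hzb
    rw [ha1 _ hve] at hz
    exact (hxB e he hve).2.2.2.2.1 ⟨hz, hzb⟩

/-- Free directions at the centre of a star. -/
lemma cone_acc {K : Set ℂ} {p : ℂ} {r : ℝ} (hr : 0 < r) {X : Set ℂ} (hX : X.Finite)
    (hXr : ∀ x ∈ X, Dist.dist x p = r)
    (hK : ∀ z ∈ K, z ∈ Metric.closedBall p r → z = p ∨ ∃ x ∈ X, z ∈ segment ℝ p x)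
    {x : ℂ} (hx : Dist.dist x p = r) (hxX : x ∉ X) {t : ℝ} (ht : t ∈ Set.Ioo (0:ℝ) 1) :
    ConeAcc K p (AffineMap.lineMap p x t) := by
  set y : ℂ := AffineMap.lineMap p x t with hy
  have hyp : Dist.dist y p = t * r := by
    rw [hy, dist_lineMap_left, _root_.dist_comm p x, hx, Real.norm_eq_abs, abs_of_pos ht.1]
  have hyn : y ≠ p := by
    intro h
    rw [h, _root_.dist_self] at hyp
    exact (mul_pos ht.1 hr).ne hyp
  have hcl : IsClosed (⋃ x' ∈ X, segment ℝ p x') := by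
    apply IsCompact.isClosed
    refine hX.isCompact_biUnion (fun x' _ => ?_)
    rw [segment_eq_image_lineMap]
    exact isCompact_Icc.image AffineMap.lineMap_continuous
  have hyR : y ∉ ⋃ x' ∈ X, segment ℝ p x' := by
    simp only [Set.mem_iUnion, not_exists]
    intro x' hx' hmem
    apply hyn
    refine seg_sphere_inter hr hx (hXr x' hx') (fun h => hxX (h ▸ hx')) ?_ hmem
    rw [segment_eq_image_lineMap]
    exact ⟨t, ⟨ht.1.le, ht.2.le⟩, rfl⟩
  obtain ⟨ρ, hρ, hball⟩ := Metric.isOpen_iff.1 hcl.isOpen_compl y hyR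
  have htr : 0 < t * r := mul_pos ht.1 hr
  have htr' : 0 < r - t * r := by nlinarith [ht.2]
  refine ⟨min ρ (min (t * r) (r - t * r)), lt_min hρ (lt_min htr htr'), ?_⟩
  intro z hz τ hτ hmem
  rw [Metric.mem_ball, lt_min_iff, lt_min_iff] at hz
  obtain ⟨hz1, hz2, hz3⟩ := hz
  have hzp : z ≠ p := by
    rintro rfl
    rw [_root_.dist_comm, hyp] at hz2
    exact lt_irrefl _ hz2
  have hzr : Dist.dist z p < r := by
    have := dist_triangle z y p
    linarith
  have hd : Dist.dist (AffineMap.lineMap p z τ : ℂ) p = τ * Dist.dist z p := by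
    rw [dist_lineMap_left, _root_.dist_comm p z, Real.norm_eq_abs, abs_of_pos hτ.1]
  have hcb : (AffineMap.lineMap p z τ : ℂ) ∈ Metric.closedBall p r := by
    rw [Metric.mem_closedBall, hd]
    have := dist_nonneg (x := z) (y := p)
    nlinarith [hτ.1, hτ.2]
  have hτ0 : τ ≠ 0 := hτ.1.ne'
  rcases hK _ hmem hcb with h | ⟨x', hx', h⟩
  · rw [h, _root_.dist_self] at hd
    have : 0 < Dist.dist z p := dist_pos.2 hzp
    have := mul_pos hτ.1 this
    linarith
  · apply hball hz1
    simp only [Set.mem_iUnion]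
    refine ⟨x', hx', ?_⟩
    rw [segment_eq_image'] at h ⊢
    obtain ⟨s, hs, hsz⟩ := h
    simp only [AffineMap.lineMap_apply, vsub_eq_sub, vadd_eq_add, Complex.real_smul] at hsz
    have hτc : (τ : ℂ) ≠ 0 := by exact_mod_cast hτ0
    have hzeq : z = p + (s / τ) • (x' - p) := by
      rw [Complex.real_smul]
      push_cast
      field_simp
      linear_combination -hsz
    have hn : s * r ≤ τ * r := by
      have h1 : Dist.dist z p = s / τ * r := by
        rw [hzeq, dist_eq_norm, add_sub_cancel_left, norm_smul, ← dist_eq_norm, hXr x' hx',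
          Real.norm_eq_abs, abs_of_nonneg (div_nonneg hs.1 hτ.1.le)]
      rw [h1] at hzr
      rw [div_mul_eq_mul_div, div_lt_iff₀ hτ.1] at hzr
      linarith
    refine ⟨s / τ, ⟨div_nonneg hs.1 hτ.1.le, ?_⟩, hzeq.symm⟩
    rw [div_le_one hτ.1]
    exact le_of_mul_le_mul_right hn hr

end


lemma near_param {f : ℝ → ℂ} (hc : ContinuousOn f (Set.Icc 0 1)) (hi : Set.InjOn f (Set.Icc 0 1))
    {p x : ℂ} {r : ℝ} (hr : 0 < r) (hx : Dist.dist x p = r) (f0 : f 0 = p)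
    (hseg : ∀ z ∈ f '' Set.Icc 0 1, z ∈ Metric.closedBall p r → z ∈ segment ℝ p x) :
    ∃ s ∈ Set.Ioo (0:ℝ) 1, ∃ t ∈ Set.Ioo (0:ℝ) 1, f s = AffineMap.lineMap p x t := by
  have h0 : (0:ℝ) ∈ Set.Icc (0:ℝ) 1 := by simp
  obtain ⟨δ, hδ, hd⟩ := Metric.continuousOn_iff.1 hc 0 h0 r hr
  set s := min (δ / 2) (1 / 2) with hs
  have hs0 : 0 < s := lt_min (half_pos hδ) (by norm_num)
  have hs1 : s ≤ 1 / 2 := min_le_right _ _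
  have hsd : s ≤ δ / 2 := min_le_left _ _
  have hsI : s ∈ Set.Icc (0:ℝ) 1 := ⟨hs0.le, by linarith⟩
  have hlt : Dist.dist (f s) p < r := by
    rw [← f0]
    apply hd s hsI
    rw [Real.dist_eq, sub_zero, abs_of_pos hs0]
    linarith
  have hm := hseg (f s) ⟨s, hsI, rfl⟩ (Metric.mem_closedBall.2 hlt.le)
  rw [segment_eq_image_lineMap] at hm
  obtain ⟨t, ht, hts⟩ := hm
  refine ⟨s, ⟨hs0, by linarith⟩, t, ⟨lt_of_le_of_ne ht.1 ?_, lt_of_le_of_ne ht.2 ?_⟩, hts.symm⟩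
  · rintro rfl
    rw [AffineMap.lineMap_apply_zero, ← f0] at hts
    exact hs0.ne (hi h0 hsI hts)
  · rintro rfl
    rw [AffineMap.lineMap_apply_one] at hts
    rw [← hts, hx] at hlt
    exact lt_irrefl _ hlt

section
variable {V : Type*} {E E' : Set (Sym2 V)} {A A' : Set V} {pos : V → ℂ} {arc : Sym2 V → Set ℂ}

/-- Star data at a vertex make the direction of a removed edge accessible. -/
lemma star_cone [Finite V] {v : V} {r : ℝ} (hr : 0 < r) {xs : Sym2 V → ℂ}
    (h1 : ∀ x ∈ A, pos x ∈ Metric.closedBall (pos v) r → x = v)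
    (h2 : ∀ e ∈ E, v ∉ e → ∀ z ∈ arc e, z ∉ Metric.closedBall (pos v) r)
    (h3 : ∀ e ∈ E, v ∈ e → Dist.dist (xs e) (pos v) = r ∧
        ∀ z ∈ arc e, z ∈ Metric.closedBall (pos v) r → z ∈ segment ℝ (pos v) (xs e))
    {x : ℂ} (hx : Dist.dist x (pos v) = r) (hxX : ∀ e ∈ E, v ∈ e → x ≠ xs e)
    {t : ℝ} (ht : t ∈ Set.Ioo (0:ℝ) 1) :
    ConeAcc (dimg E A pos arc) (pos v) (AffineMap.lineMap (pos v) x t) := by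
  refine cone_acc hr (X := xs '' {e ∈ E | v ∈ e}) (Set.toFinite _) ?_ ?_ hx ?_ ht
  · rintro _ ⟨e, he, rfl⟩
    exact (h3 e he.1 he.2).1
  · intro z hz hzb
    rcases mem_dimg.1 hz with ⟨y, hy, rfl⟩ | ⟨e, he, hze⟩
    · left; rw [h1 y hy hzb]
    · right
      have hve : v ∈ e := by
        by_contra hv
        exact h2 e he hv z hze hzb
      exact ⟨xs e, ⟨e, ⟨he, hve⟩, rfl⟩, (h3 e he hve).2 z hze hzb⟩
  · rintro ⟨e, he, rfl⟩
    exact hxX e he.1 he.2 rfl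

open Classical in
lemma Drw.fork [Finite V] {u w : V} (h : Drw (insert s(u, w) E) A pos arc)
    (huw : u ≠ w) : ∃ (arc' : Sym2 V → Set ℂ) (F : Set ℂ) (q : ℂ),
      Drw (insert s(u, w) E) A pos arc' ∧ IsArcC F (pos u) q ∧ q ≠ pos w ∧
      (∀ z ∈ F, z ∈ dimg (insert s(u, w) E) A pos arc' → z = pos u) ∧
      ∀ z ∈ openSegment ℝ (pos w) q, z ∉ dimg (insert s(u, w) E) A pos arc' ∧ z ∉ F := by
  set e₀ : Sym2 V := s(u, w) with he₀
  have he₀E : e₀ ∈ insert e₀ E := Set.mem_insert _ _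
  have hu : u ∈ A := h.sub e₀ he₀E u (by simp [he₀])
  have hw : w ∈ A := h.sub e₀ he₀E w (by simp [he₀])
  have hpne : pos u ≠ pos w := fun h' => huw (h.inj hu hw h')
  have hue : u ∈ e₀ := by simp [he₀]
  have hwe : w ∈ e₀ := by simp [he₀]
  obtain ⟨r1, arc1, xs1, hr1, -, D1, -, a1, b1, c1, d1⟩ := h.radialize hw one_pos
  have hd : 0 < Dist.dist (pos u) (pos w) - r1 := by
    by_contra hcon
    exact huw (a1 u hu (by rw [Metric.mem_closedBall]; linarith))
  obtain ⟨r2, arc2, xs2, hr2, hr2', D2, s2, a2, b2, c2, d2⟩ := D1.radialize hu (half_pos hd)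
  have hdisj : ∀ z, z ∈ Metric.closedBall (pos w) r1 → z ∉ Metric.closedBall (pos u) r2 := by
    intro z h1 h2
    rw [Metric.mem_closedBall] at h1 h2
    have := dist_triangle_left (pos u) (pos w) z
    linarith
  have hin : ∀ e ∈ insert e₀ E, ∀ z ∈ arc2 e, z ∈ Metric.closedBall (pos w) r1 → z ∈ arc1 e := by
    intro e he z hz hzb
    rcases s2 e he hz with h' | h'
    · exact h'
    · exact absurd h' (hdisj z hzb)
  have b1' : ∀ e ∈ insert e₀ E, w ∉ e → ∀ z ∈ arc2 e, z ∉ Metric.closedBall (pos w) r1 :=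
    fun e he hwe z hz hzb => b1 e he hwe z (hin e he z hz hzb) hzb
  have c1' : ∀ e ∈ insert e₀ E, w ∈ e → Dist.dist (xs1 e) (pos w) = r1 ∧
      ∀ z ∈ arc2 e, z ∈ Metric.closedBall (pos w) r1 → z ∈ segment ℝ (pos w) (xs1 e) :=
    fun e he hwe => ⟨(c1 e he hwe).1, fun z hz hzb => (c1 e he hwe).2 z (hin e he z hz hzb) hzb⟩
  set E0 : Set (Sym2 V) := E \ {e₀} with hE0
  have hE0s : E0 ⊆ insert e₀ E := fun e he => Or.inr he.1
  have hins : insert e₀ E0 = insert e₀ E := by rw [hE0]; exact Set.insert_sdiff_singleton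
  have D0 : Drw E0 A pos arc2 := D2.mono hE0s subset_rfl (fun e he => h.sub e (hE0s he))
  obtain ⟨f, hc, hi, f0, f1, hfA⟩ := D2.isArc u w he₀E
  obtain ⟨s, hs, t, ht, hst⟩ := near_param hc hi hr2 (c2 e₀ he₀E hue).1 f0
    (by rw [hfA]; exact (c2 e₀ he₀E hue).2)
  have hmaps : Set.MapsTo (fun s : ℝ => 1 - s) (Set.Icc 0 1) (Set.Icc 0 1) := by
    intro s hs; constructor <;> simp <;> linarith [hs.1, hs.2]
  obtain ⟨s', hs', t', ht', hst'⟩ := near_param (f := fun s => f (1 - s))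
    (hc.comp (by fun_prop) hmaps)
    (fun a ha b hb hab => by
      have := hi (hmaps ha) (hmaps hb) hab
      simpa using this) hr1 (c1' e₀ he₀E hwe).1 (by simpa using f1)
    (by
      rintro _ ⟨a, ha, rfl⟩
      exact (c1' e₀ he₀E hwe).2 _ (by rw [← hfA]; exact ⟨1 - a, hmaps ha, rfl⟩))
  have hx := star_cone (E := E0) (arc := arc2) hr2 a2 (fun e he => b2 e (hE0s he))
    (fun e he => c2 e (hE0s he)) (c2 e₀ he₀E hue).1
    (fun e he hue' => d2 e₀ he₀E e (hE0s he) hue hue' (fun h' => he.2 h'.symm)) ht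
  have hy := star_cone (E := E0) (arc := arc2) hr1 a1 (fun e he => b1' e (hE0s he))
    (fun e he => c1' e (hE0s he)) (c1' e₀ he₀E hwe).1
    (fun e he hue' => d1 e₀ he₀E e (hE0s he) hwe hue' (fun h' => he.2 h'.symm)) ht'
  rw [← hst] at hx
  rw [← hst'] at hy
  have hIoo : Set.Ioo (0:ℝ) 1 ⊆ Set.Icc 0 1 := Set.Ioo_subset_Icc_self
  have hCK : f '' Set.Ioo 0 1 ⊆ (dimg E0 A pos arc2)ᶜ := by
    rintro _ ⟨a, ha, rfl⟩ hmem
    have hfa : f a ∈ arc2 e₀ := by rw [he₀, ← hfA]; exact ⟨a, hIoo ha, rfl⟩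
    have key : ∀ y, y ∈ e₀ → f a ≠ pos y := by
      intro y hy hfy
      rcases Sym2.mem_iff.1 hy with rfl | rfl
      · rw [← f0] at hfy
        exact ha.1.ne' (hi (hIoo ha) (by simp) hfy)
      · rw [← f1] at hfy
        exact ha.2.ne (hi (hIoo ha) (by simp) hfy)
    rcases mem_dimg.1 hmem with ⟨y, hy, hya⟩ | ⟨e, he, hze⟩
    · exact key y (D2.posarc e₀ he₀E y hy (by rw [hya]; exact hfa)) hya.symm
    · obtain ⟨y, hy, -, hya⟩ := D2.inter e₀ he₀E e (hE0s he) (fun h' => he.2 h'.symm) _ hfa hze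
      exact key y hy hya
  obtain ⟨P, F, q, hP, hF, hq, hPK, hFK, hPF, hseg⟩ := double D0.compact.isClosed hpne
    (pos_mem_dimg hu) (pos_mem_dimg hw) hx hy
    (isPreconnected_Ioo.image f (hc.mono hIoo)) hCK ⟨s, hs, rfl⟩
    ⟨1 - s', ⟨by linarith [hs'.2], by linarith [hs'.1]⟩, rfl⟩
  have D3 := D0.addArc hu hw (fun h' => h'.2 rfl) hP hPK
  rw [← he₀, hins] at D3
  have hdm : ∀ z, z ∈ dimg (insert e₀ E) A pos (fun e => if e = e₀ then P else arc2 e) →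
      z ∈ dimg E0 A pos arc2 ∨ z ∈ P := by
    intro z hz
    rcases mem_dimg.1 hz with ⟨y, hy, rfl⟩ | ⟨e, he, hze⟩
    · exact Or.inl (pos_mem_dimg hy)
    · by_cases hee : e = e₀
      · right; simpa [hee] using hze
      · left
        simp only [hee, if_false] at hze
        exact arc_mem_dimg (E := E0) ⟨he.resolve_left hee, hee⟩ hze
  refine ⟨_, F, q, D3, hF, hq, ?_, ?_⟩
  · intro z hz hzd
    rcases hdm z hzd with h' | h'
    · exact hFK z hz h'
    · exact hPF z h' hz
  · intro z hz
    obtain ⟨z1, z2, z3⟩ := hseg z hz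
    exact ⟨fun hzd => (hdm z hzd).elim z1 z2, z3⟩

/-- A free slit at a vertex. -/
lemma Drw.slit [Finite V] {w : V} (h : Drw E A pos arc) (hw : w ∈ A) :
    ∃ (arc' : Sym2 V → Set ℂ) (q : ℂ), Drw E A pos arc' ∧ q ≠ pos w ∧
      q ∉ dimg E A pos arc' ∧ ∀ z ∈ openSegment ℝ (pos w) q, z ∉ dimg E A pos arc' := by
  obtain ⟨r, arc', xs, hr, -, D, -, a, b, c, d⟩ := h.radialize hw one_pos
  have hinf : (Metric.sphere (pos w) r).Infinite := by
    have hpc : IsPreconnected (Metric.sphere (pos w) r) :=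
      isPreconnected_sphere (by rw [Complex.rank_real_complex]; norm_num) _ _
    refine hpc.infinite_of_nontrivial ⟨pos w + r, ?_, pos w - r, ?_, ?_⟩
    · simp [abs_of_pos hr]
    · simp [abs_of_pos hr]
    · intro h'
      have : (2 * r : ℂ) = 0 := by linear_combination h'
      simp [hr.ne'] at this
  obtain ⟨x, hx, hxX⟩ := hinf.exists_notMem_finite (Set.toFinite (xs '' {e ∈ E | w ∈ e}))
  have hca := star_cone (A := A) (E := E) (arc := arc') (x := x) (t := 1 / 2) hr a b c hx
    (fun e he hwe h' => hxX ⟨e, ⟨he, hwe⟩, h'.symm⟩) ⟨by norm_num, by norm_num⟩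
  obtain ⟨ρ, hρ, hcone⟩ := hca
  set q : ℂ := AffineMap.lineMap (pos w) x (1 / 2 : ℝ) with hq
  have hc := hcone q (Metric.mem_ball_self hρ)
  have hq1 := hc 1 ⟨one_pos, le_rfl⟩
  rw [AffineMap.lineMap_apply_one] at hq1
  refine ⟨arc', q, D, fun h' => hq1 (h' ▸ pos_mem_dimg hw), hq1, ?_⟩
  intro z hz
  rw [openSegment_eq_image_lineMap] at hz
  obtain ⟨τ, hτ, rfl⟩ := hz
  exact hc τ ⟨hτ.1, hτ.2.le⟩

end


section
variable {V : Type*} {E E' E₁ E₂ : Set (Sym2 V)} {A A' A₁ A₂ : Set V} {pos pos₁ pos₂ : V → ℂ}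
  {arc arc₁ arc₂ : Sym2 V → Set ℂ}

lemma Drw.wing1 [Finite V] {u w : V} (h : Drw (insert s(u, w) E) A pos arc)
    (huw : u ≠ w) : ∃ (pos' : V → ℂ) (arc' : Sym2 V → Set ℂ) (F : Set ℂ),
      Drw (insert s(u, w) E) A pos' arc' ∧ pos' w = Complex.I ∧
      (∀ z ∈ dimg (insert s(u, w) E) A pos' arc', 0 < z.re ∨ z = Complex.I) ∧
      IsArcC F (pos' u) 0 ∧ (∀ z ∈ F, 0 < z.re ∨ z = 0) ∧
      (∀ z ∈ F, z ∈ dimg (insert s(u, w) E) A pos' arc' → z = pos' u) := by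
  obtain ⟨arc1, F, q, D, hF, hqw, hFd, hseg⟩ := h.fork huw
  have hu : u ∈ A := h.sub _ (Set.mem_insert _ _) u (by simp)
  have hw : w ∈ A := h.sub _ (Set.mem_insert _ _) w (by simp)
  have hpne : pos u ≠ pos w := fun h' => huw (h.inj hu hw h')
  have hM : dimg (insert s(u, w) E) A pos arc1 ⊆ (openSegment ℝ (pos w) q)ᶜ :=
    fun z hz hz' => (hseg z hz').1 hz
  have hMF : F ⊆ (openSegment ℝ (pos w) q)ᶜ := fun z hz hz' => (hseg z hz').2 hz
  have hc := slitMap_continuousOn hqw.symm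
  have hi := slitMap_injOn hqw.symm
  have hqd : q ∉ dimg (insert s(u, w) E) A pos arc1 := fun hq =>
    hF.ne (hFd q hF.right_mem hq).symm
  refine ⟨_, _, slitMap (pos w) q '' F, D.map hM hc hi, slitMap_w hqw.symm, ?_, ?_, ?_, ?_⟩
  · rw [dimg_map]
    rintro _ ⟨z, hz, rfl⟩
    by_cases hzw : z = pos w
    · right; rw [hzw, slitMap_w hqw.symm]
    · left; exact slitMap_re_pos (hM hz) hzw (fun h' => hqd (h' ▸ hz))
  · have := hF.image (hc.mono hMF) (hi.mono hMF)
    rwa [slitMap_q] at this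
  · rintro _ ⟨z, hz, rfl⟩
    by_cases hzq : z = q
    · right; rw [hzq, slitMap_q]
    · left
      refine slitMap_re_pos (hMF hz) ?_ hzq
      rintro rfl
      exact hpne (hFd _ hz (pos_mem_dimg hw)).symm
  · rw [dimg_map]
    rintro _ ⟨z, hz, rfl⟩ ⟨z', hz', heq⟩
    have := hi (hM hz') (hMF hz) heq
    subst this
    exact congrArg _ (hFd _ hz hz')

lemma Drw.wing0 [Finite V] {w : V} (h : Drw E A pos arc)
    (hw : w ∈ A) : ∃ (pos' : V → ℂ) (arc' : Sym2 V → Set ℂ),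
      Drw E A pos' arc' ∧ pos' w = Complex.I ∧
      (∀ z ∈ dimg E A pos' arc', 0 < z.re ∨ z = Complex.I) := by
  obtain ⟨arc1, q, D, hqw, hqd, hseg⟩ := h.slit hw
  have hM : dimg E A pos arc1 ⊆ (openSegment ℝ (pos w) q)ᶜ :=
    fun z hz hz' => (hseg z hz') hz
  have hc := slitMap_continuousOn hqw.symm
  have hi := slitMap_injOn hqw.symm
  refine ⟨_, _, D.map hM hc hi, slitMap_w hqw.symm, ?_⟩
  rw [dimg_map]
  rintro _ ⟨z, hz, rfl⟩
  by_cases hzw : z = pos w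
  · right; rw [hzw, slitMap_w hqw.symm]
  · left; exact slitMap_re_pos (hM hz) hzw (fun h' => hqd (h' ▸ hz))

/-- Reflection in the imaginary axis. -/
noncomputable def refl0 (z : ℂ) : ℂ := - (starRingEnd ℂ) z

lemma refl0_re (z : ℂ) : (refl0 z).re = - z.re := by simp [refl0]
lemma refl0_zero : refl0 0 = 0 := by simp [refl0]
lemma refl0_I : refl0 Complex.I = Complex.I := by simp [refl0]
lemma refl0_cont : Continuous refl0 := by
  unfold refl0; exact (Complex.continuous_conj).neg
lemma refl0_inj : Function.Injective refl0 := by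
  intro a b h
  exact star_injective (neg_injective h)

lemma Drw.wing1_left [Finite V] {u w : V} (h : Drw (insert s(u, w) E) A pos arc)
    (huw : u ≠ w) : ∃ (pos' : V → ℂ) (arc' : Sym2 V → Set ℂ) (F : Set ℂ),
      Drw (insert s(u, w) E) A pos' arc' ∧ pos' w = Complex.I ∧
      (∀ z ∈ dimg (insert s(u, w) E) A pos' arc', z.re < 0 ∨ z = Complex.I) ∧
      IsArcC F (pos' u) 0 ∧ (∀ z ∈ F, z.re < 0 ∨ z = 0) ∧
      (∀ z ∈ F, z ∈ dimg (insert s(u, w) E) A pos' arc' → z = pos' u) := by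
  obtain ⟨pos', arc', F, D, hI, hd, hF, hFr, hFd⟩ := h.wing1 huw
  refine ⟨_, _, refl0 '' F, D.map (Set.subset_univ _) refl0_cont.continuousOn refl0_inj.injOn,
    by simp only [hI, refl0_I], ?_, ?_, ?_, ?_⟩
  · rw [dimg_map]
    rintro _ ⟨z, hz, rfl⟩
    rw [refl0_re]
    exact (hd z hz).imp (fun h => by linarith) (fun h => by rw [h, refl0_I])
  · have := hF.image refl0_cont.continuousOn refl0_inj.injOn
    rwa [refl0_zero] at this
  · rintro _ ⟨z, hz, rfl⟩
    rw [refl0_re]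
    exact (hFr z hz).imp (fun h => by linarith) (fun h => by rw [h, refl0_zero])
  · rw [dimg_map]
    rintro _ ⟨z, hz, rfl⟩ ⟨z', hz', heq⟩
    have := refl0_inj heq
    subst this
    exact congrArg _ (hFd _ hz hz')

lemma Drw.wing0_left [Finite V] {w : V} (h : Drw E A pos arc)
    (hw : w ∈ A) : ∃ (pos' : V → ℂ) (arc' : Sym2 V → Set ℂ),
      Drw E A pos' arc' ∧ pos' w = Complex.I ∧
      (∀ z ∈ dimg E A pos' arc', z.re < 0 ∨ z = Complex.I) := by
  obtain ⟨pos', arc', D, hI, hd⟩ := h.wing0 hw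
  refine ⟨_, _, D.map (Set.subset_univ _) refl0_cont.continuousOn refl0_inj.injOn,
    by simp only [hI, refl0_I], ?_⟩
  rw [dimg_map]
  rintro _ ⟨z, hz, rfl⟩
  rw [refl0_re]
  exact (hd z hz).imp (fun h => by linarith) (fun h => by rw [h, refl0_I])

open Classical in
/-- Gluing two drawings in opposite half planes at a common vertex. -/
lemma Drw.glue {w : V} (h₁ : Drw E₁ A₁ pos₁ arc₁) (h₂ : Drw E₂ A₂ pos₂ arc₂)
    (hA : ∀ x ∈ A₁, x ∈ A₂ → x = w) (hw₁ : w ∈ A₁) (hw₂ : w ∈ A₂)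
    (hI₁ : pos₁ w = Complex.I) (hI₂ : pos₂ w = Complex.I)
    (hd₁ : ∀ z ∈ dimg E₁ A₁ pos₁ arc₁, 0 < z.re ∨ z = Complex.I)
    (hd₂ : ∀ z ∈ dimg E₂ A₂ pos₂ arc₂, z.re < 0 ∨ z = Complex.I) :
    ∃ (pos : V → ℂ) (arc : Sym2 V → Set ℂ), Drw (E₁ ∪ E₂) (A₁ ∪ A₂) pos arc ∧
      (∀ x ∈ A₁, pos x = pos₁ x) ∧ (∀ x ∈ A₂, pos x = pos₂ x) ∧
      (∀ z ∈ dimg (E₁ ∪ E₂) (A₁ ∪ A₂) pos arc,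
        z ∈ dimg E₁ A₁ pos₁ arc₁ ∨ z ∈ dimg E₂ A₂ pos₂ arc₂) := by
  have hEE : ∀ e ∈ E₁, e ∉ E₂ := by
    intro e he he2
    induction e using Sym2.ind with
    | _ x y =>
      have hx := hA x (h₁.sub _ he x (by simp)) (h₂.sub _ he2 x (by simp))
      have hy := hA y (h₁.sub _ he y (by simp)) (h₂.sub _ he2 y (by simp))
      exact (h₁.isArc x y he).ne (by rw [hx, hy])
  set pos : V → ℂ := fun x => if x ∈ A₁ then pos₁ x else pos₂ x with hpos
  set arc : Sym2 V → Set ℂ := fun e => if e ∈ E₁ then arc₁ e else arc₂ e with harc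
  have p1 : ∀ x ∈ A₁, pos x = pos₁ x := fun x hx => by simp [hpos, hx]
  have p2 : ∀ x ∈ A₂, pos x = pos₂ x := fun x hx => by
    by_cases h : x ∈ A₁
    · rw [p1 x h, hA x h hx, hI₁, hI₂]
    · simp [hpos, h]
  have q1 : ∀ e ∈ E₁, arc e = arc₁ e := fun e he => by simp [harc, he]
  have q2 : ∀ e ∈ E₂, arc e = arc₂ e := fun e he => by
    have : e ∉ E₁ := fun h => hEE e h he
    simp [harc, this]
  have hmeet : ∀ z ∈ dimg E₁ A₁ pos₁ arc₁, z ∈ dimg E₂ A₂ pos₂ arc₂ → z = Complex.I := by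
    intro z h1 h2
    rcases hd₁ z h1 with h1 | h1
    · rcases hd₂ z h2 with h2 | h2
      · linarith
      · exact h2
    · exact h1
  have v1 : ∀ x ∈ A₁, pos₁ x = Complex.I → x = w := fun x hx h =>
    h₁.inj hx hw₁ (h.trans hI₁.symm)
  have v2 : ∀ x ∈ A₂, pos₂ x = Complex.I → x = w := fun x hx h =>
    h₂.inj hx hw₂ (h.trans hI₂.symm)
  have w1 : ∀ e ∈ E₁, Complex.I ∈ arc₁ e → w ∈ e := fun e he h =>
    h₁.posarc e he w hw₁ (hI₁ ▸ h)
  have w2 : ∀ e ∈ E₂, Complex.I ∈ arc₂ e → w ∈ e := fun e he h =>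
    h₂.posarc e he w hw₂ (hI₂ ▸ h)
  refine ⟨pos, arc, ⟨?_, ?_, ?_, ?_, ?_⟩, p1, p2, ?_⟩
  · rintro e (he | he) x hx
    · exact Or.inl (h₁.sub e he x hx)
    · exact Or.inr (h₂.sub e he x hx)
  · rintro x (hx | hx) y (hy | hy) hxy
    · rw [p1 x hx, p1 y hy] at hxy
      exact h₁.inj hx hy hxy
    · rw [p1 x hx, p2 y hy] at hxy
      have hz := hmeet (pos₁ x) (pos_mem_dimg hx) (hxy ▸ pos_mem_dimg hy)
      rw [v1 x hx hz, v2 y hy (hxy ▸ hz)]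
    · rw [p2 x hx, p1 y hy] at hxy
      have hz := hmeet (pos₁ y) (pos_mem_dimg hy) (hxy ▸ pos_mem_dimg hx)
      rw [v1 y hy hz, v2 x hx (hxy ▸ hz)]
    · rw [p2 x hx, p2 y hy] at hxy
      exact h₂.inj hx hy hxy
  · rintro u v (he | he)
    · rw [q1 _ he, p1 u (h₁.sub _ he u (by simp)), p1 v (h₁.sub _ he v (by simp))]
      exact h₁.isArc u v he
    · rw [q2 _ he, p2 u (h₂.sub _ he u (by simp)), p2 v (h₂.sub _ he v (by simp))]
      exact h₂.isArc u v he
  · rintro e (he | he) e' (he' | he') hne z hz hz'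
    · rw [q1 _ he] at hz
      rw [q1 _ he'] at hz'
      obtain ⟨v, hv, hv', rfl⟩ := h₁.inter e he e' he' hne z hz hz'
      exact ⟨v, hv, hv', (p1 v (h₁.sub _ he v hv)).symm⟩
    · rw [q1 _ he] at hz
      rw [q2 _ he'] at hz'
      have := hmeet z (arc_mem_dimg he hz) (arc_mem_dimg he' hz')
      subst this
      exact ⟨w, w1 e he hz, w2 e' he' hz', by rw [p1 w hw₁, hI₁]⟩
    · rw [q2 _ he] at hz
      rw [q1 _ he'] at hz'
      have := hmeet z (arc_mem_dimg he' hz') (arc_mem_dimg he hz)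
      subst this
      exact ⟨w, w2 e he hz, w1 e' he' hz', by rw [p1 w hw₁, hI₁]⟩
    · rw [q2 _ he] at hz
      rw [q2 _ he'] at hz'
      obtain ⟨v, hv, hv', rfl⟩ := h₂.inter e he e' he' hne z hz hz'
      exact ⟨v, hv, hv', (p2 v (h₂.sub _ he v hv)).symm⟩
  · rintro e (he | he) v (hv | hv) hz
    · rw [q1 _ he, p1 v hv] at hz
      exact h₁.posarc e he v hv hz
    · rw [q1 _ he, p2 v hv] at hz
      have := hmeet _ (arc_mem_dimg he hz) (pos_mem_dimg hv)
      rw [this] at hz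
      rw [v2 v hv this]
      exact w1 e he hz
    · rw [q2 _ he, p1 v hv] at hz
      have := hmeet _ (pos_mem_dimg hv) (arc_mem_dimg he hz)
      rw [this] at hz
      rw [v1 v hv this]
      exact w2 e he hz
    · rw [q2 _ he, p2 v hv] at hz
      exact h₂.posarc e he v hv hz
  · intro z hz
    rcases mem_dimg.1 hz with ⟨x, hx | hx, rfl⟩ | ⟨e, he | he, hz⟩
    · left; rw [p1 x hx]; exact pos_mem_dimg hx
    · right; rw [p2 x hx]; exact pos_mem_dimg hx
    · left; rw [q1 e he] at hz; exact arc_mem_dimg he hz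
    · right; rw [q2 e he] at hz; exact arc_mem_dimg he hz

end


/-- The graph with vertex set `A` and edge set `E` has a planar drawing. -/
def Pl {V : Type*} (E : Set (Sym2 V)) (A : Set V) : Prop := ∃ pos arc, Drw E A pos arc

section
variable {V : Type*} {E E' E₁ E₂ : Set (Sym2 V)} {A A' A₁ A₂ : Set V} {pos pos₁ pos₂ : V → ℂ}
  {arc arc₁ arc₂ : Sym2 V → Set ℂ}

lemma Pl.mono (h : Pl E A) (hE : E' ⊆ E) (hA : A' ⊆ A)
    (hs : ∀ e ∈ E', ∀ x ∈ e, x ∈ A') : Pl E' A' := by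
  obtain ⟨pos, arc, h⟩ := h
  exact ⟨pos, arc, h.mono hE hA hs⟩

open Classical in
lemma Pl.ext [Finite V] (h : Pl E A) (hA : A ⊆ A') : Pl E A' := by
  obtain ⟨pos, arc, h⟩ := h
  obtain ⟨R, hR⟩ := h.compact.isBounded.exists_norm_le
  obtain ⟨n, ⟨ι⟩⟩ := Finite.exists_equiv_fin V
  set pos' : V → ℂ := fun x => if x ∈ A then pos x else ((|R| + 1 + (ι x : ℕ) : ℝ) : ℂ) with hpos
  have p1 : ∀ x ∈ A, pos' x = pos x := fun x hx => by simp [hpos, hx]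
  have p2 : ∀ x ∉ A, pos' x = ((|R| + 1 + (ι x : ℕ) : ℝ) : ℂ) := fun x hx => by simp [hpos, hx]
  have hout : ∀ x ∉ A, pos' x ∉ dimg E A pos arc := by
    intro x hx hmem
    have := hR _ hmem
    rw [p2 x hx, Complex.norm_real, Real.norm_eq_abs, abs_of_nonneg (by positivity)] at this
    have h0 : (0:ℝ) ≤ ((ι x : ℕ) : ℝ) := Nat.cast_nonneg _
    linarith [le_abs_self R]
  refine ⟨pos', arc, ?_, ?_, ?_, ?_, ?_⟩
  · exact fun e he x hx => hA (h.sub e he x hx)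
  · intro x _ y _ hxy
    by_cases hx : x ∈ A <;> by_cases hy : y ∈ A
    · rw [p1 x hx, p1 y hy] at hxy
      exact h.inj hx hy hxy
    · exact absurd (by rw [← hxy, p1 x hx]; exact pos_mem_dimg hx) (hout y hy)
    · exact absurd (by rw [hxy, p1 y hy]; exact pos_mem_dimg hy) (hout x hx)
    · rw [p2 x hx, p2 y hy] at hxy
      have h1 := Complex.ofReal_injective hxy
      have h2 : ((ι x : ℕ) : ℝ) = ((ι y : ℕ) : ℝ) := by linarith
      exact ι.injective (Fin.ext (Nat.cast_injective h2))
  · intro u v he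
    rw [p1 u (h.sub _ he u (by simp)), p1 v (h.sub _ he v (by simp))]
    exact h.isArc u v he
  · intro e he e' he' hne z hz hz'
    obtain ⟨v, hv, hv', rfl⟩ := h.inter e he e' he' hne z hz hz'
    exact ⟨v, hv, hv', (p1 v (h.sub _ he v hv)).symm⟩
  · intro e he v hv hz
    by_cases hvA : v ∈ A
    · rw [p1 v hvA] at hz
      exact h.posarc e he v hvA hz
    · exact absurd (arc_mem_dimg he hz) (hout v hvA)

lemma Pl.glue [Finite V] {w : V} (h₁ : Pl E₁ A₁) (h₂ : Pl E₂ A₂) (hw : w ∈ A₁)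
    (hA : ∀ x ∈ A₁, x ∈ A₂ → x = w) : Pl (E₁ ∪ E₂) (A₁ ∪ A₂) := by
  have h₂' : Pl E₂ (insert w A₂) := h₂.ext (Set.subset_insert _ _)
  have hAA : A₁ ∪ A₂ = A₁ ∪ insert w A₂ := by
    ext x; simp only [Set.mem_union, Set.mem_insert_iff]
    constructor
    · tauto
    · rintro (h | rfl | h) <;> tauto
  rw [hAA]
  obtain ⟨pos₁, arc₁, D₁⟩ := h₁
  obtain ⟨pos₂, arc₂, D₂⟩ := h₂'
  obtain ⟨_, _, D₁', i1, d1⟩ := D₁.wing0 hw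
  obtain ⟨_, _, D₂', i2, d2⟩ := D₂.wing0_left (Set.mem_insert w A₂)
  obtain ⟨pos, arc, D, -⟩ := D₁'.glue D₂' (w := w)
    (by rintro x hx (rfl | hx') <;> [rfl; exact hA x hx hx']) hw (Set.mem_insert w A₂) i1 i2 d1 d2
  exact ⟨pos, arc, D⟩

lemma Pl.glueEdge [Finite V] {u v w : V} (h₁ : Pl (insert s(u, w) E₁) A₁)
    (h₂ : Pl (insert s(v, w) E₂) A₂) (hu : u ≠ w) (hv : v ≠ w)
    (hA : ∀ x ∈ A₁, x ∈ A₂ → x = w) : Pl (insert s(u, v) (E₁ ∪ E₂)) (A₁ ∪ A₂) := by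
  classical
  obtain ⟨pos₁, arc₁, D₁⟩ := h₁
  obtain ⟨pos₂, arc₂, D₂⟩ := h₂
  obtain ⟨p1, a1, F1, D1, i1, d1, hF1, hr1, hF1d⟩ := D₁.wing1 hu
  obtain ⟨p2, a2, F2, D2, i2, d2, hF2, hr2, hF2d⟩ := D₂.wing1_left hv
  have hu1 : u ∈ A₁ := D1.sub _ (Set.mem_insert _ _) u (by simp)
  have hw1 : w ∈ A₁ := D1.sub _ (Set.mem_insert _ _) w (by simp)
  have hv2 : v ∈ A₂ := D2.sub _ (Set.mem_insert _ _) v (by simp)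
  have hw2 : w ∈ A₂ := D2.sub _ (Set.mem_insert _ _) w (by simp)
  have hu2 : u ∉ A₂ := fun h => hu (hA u hu1 h)
  have hv1 : v ∉ A₁ := fun h => hv (hA v h hv2)
  obtain ⟨pos, arc, D, e1, e2, hd⟩ := D1.glue D2 hA hw1 hw2 i1 i2 d1 d2
  have hsub : E₁ ∪ E₂ ⊆ insert s(u, w) E₁ ∪ insert s(v, w) E₂ := by
    rintro e (he | he)
    · exact Or.inl (Or.inr he)
    · exact Or.inr (Or.inr he)
  have D' := D.mono hsub subset_rfl (fun e he => D.sub e (hsub he))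
  have hd' : ∀ z ∈ dimg (E₁ ∪ E₂) (A₁ ∪ A₂) pos arc,
      z ∈ dimg (insert s(u, w) E₁) A₁ p1 a1 ∨ z ∈ dimg (insert s(v, w) E₂) A₂ p2 a2 := by
    intro z hz
    apply hd
    rcases mem_dimg.1 hz with ⟨x, hx, rfl⟩ | ⟨e, he, hze⟩
    · exact pos_mem_dimg hx
    · exact arc_mem_dimg (hsub he) hze
  have hn : s(u, v) ∉ E₁ ∪ E₂ := by
    rintro (he | he)
    · exact hv1 (D1.sub _ (Or.inr he) v (by simp))
    · exact hu2 (D2.sub _ (Or.inr he) u (by simp))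
  have hF : IsArcC (F1 ∪ F2) (pos u) (pos v) := by
    rw [e1 u hu1, e2 v hv2]
    refine hF1.trans hF2.symm ?_
    intro z hz1 hz2
    rcases hr1 z hz1 with h1 | h1
    · rcases hr2 z hz2 with h2 | h2
      · linarith
      · exact h2
    · exact h1
  refine ⟨_, _, D'.addArc (Or.inl hu1) (Or.inr hv2) hn hF ?_⟩
  have hI0 : (Complex.I : ℂ) ≠ 0 := Complex.I_ne_zero
  rintro z (hz | hz) hzd
  · left
    rw [e1 u hu1]
    rcases hd' z hzd with h | h
    · exact hF1d z hz h
    · exfalso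
      rcases hr1 z hz with h1 | h1 <;> rcases d2 z h with h2 | h2
      · linarith
      · rw [h2] at h1; simp at h1
      · rw [h1] at h2; simp at h2
      · exact hI0 (h2.symm.trans h1)
  · right
    rw [e2 v hv2]
    rcases hd' z hzd with h | h
    · exfalso
      rcases hr2 z hz with h1 | h1 <;> rcases d1 z h with h2 | h2
      · linarith
      · rw [h2] at h1; simp at h1
      · rw [h1] at h2; simp at h2
      · exact hI0 (h2.symm.trans h1)
    · exact hF2d z hz h

lemma Drw.pathArc (D : Drw E A pos arc) {G : SimpleGraph V} {v w : V} (p : G.Walk v w)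
    (hp : p.IsPath) (hvw : v ≠ w) (hE : ∀ e ∈ p.edges, e ∈ E) :
    ∃ P, IsArcC P (pos v) (pos w) ∧ ∀ z ∈ P, ∃ e ∈ p.edges, z ∈ arc e := by
  induction p with
  | nil => exact absurd rfl hvw
  | @cons v x w h p ih =>
    rw [Walk.cons_isPath_iff] at hp
    have he : s(v, x) ∈ E := hE _ (by simp)
    by_cases hxw : x = w
    · subst hxw
      exact ⟨_, D.isArc v x he, fun z hz => ⟨_, by simp, hz⟩⟩
    · obtain ⟨P, hP, hPe⟩ := ih hp.1 hxw (fun e he => hE e (by simp [he]))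
      refine ⟨_, (D.isArc v x he).trans hP ?_, ?_⟩
      · intro z hz hzP
        obtain ⟨e, hep, hze⟩ := hPe z hzP
        have hve : v ∉ e := fun hv => hp.2 (Walk.mem_support_of_mem_edges hep hv)
        obtain ⟨y, hy, hy', rfl⟩ := D.inter _ he e (hE e (by simp [hep]))
          (by rintro rfl; exact hve (by simp)) z hz hze
        rcases Sym2.mem_iff.1 hy with rfl | rfl
        · exact absurd hy' hve
        · rfl
      · rintro z (hz | hz)
        · exact ⟨_, by simp, hz⟩
        · obtain ⟨e, hep, hze⟩ := hPe z hz
          exact ⟨e, by simp [hep], hze⟩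

lemma Pl.contract {G : SimpleGraph V} {u v w : V} (h : Pl (insert s(u, v) E) A)
    (hE₁ : E₁ ⊆ E) (hs : ∀ e ∈ E₁, ∀ x ∈ e, x ∈ A₁) (hA₁ : A₁ ⊆ A)
    (hu : u ∈ A₁) (hw : w ∈ A₁) (huw : u ≠ w)
    (hA : ∀ x ∈ A₁, x ∈ A₂ → x = w) (p : G.Walk v w) (hp : ∀ x ∈ p.support, x ∈ A₂)
    (hpE : ∀ e ∈ p.edges, e ∈ E) : Pl (insert s(u, w) E₁) A₁ := by
  classical
  have hs' : ∀ e ∈ insert s(u, w) E₁, ∀ x ∈ e, x ∈ A₁ := by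
    rintro e (rfl | he) x hx
    · rcases Sym2.mem_iff.1 hx with rfl | rfl <;> assumption
    · exact hs e he x hx
  by_cases hvw : v = w
  · subst hvw
    exact h.mono (Set.insert_subset_insert hE₁) hA₁ hs'
  by_cases hin : s(u, w) ∈ E₁
  · exact h.mono (by rw [Set.insert_eq_of_mem hin]; exact hE₁.trans (Set.subset_insert _ _)) hA₁ hs'
  obtain ⟨pos, arc, D⟩ := h
  have heE : s(u, v) ∈ insert s(u, v) E := Set.mem_insert _ _
  have hpE' : ∀ e ∈ p.bypass.edges, e ∈ E := fun e he => hpE e (p.edges_bypass_subset_edges he)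
  have hpA : ∀ e ∈ p.bypass.edges, ∀ x ∈ e, x ∈ A₂ := fun e he x hx =>
    hp x (p.support_bypass_subset_support (Walk.mem_support_of_mem_edges he hx))
  have hu2 : u ∉ A₂ := fun h => huw (hA u hu h)
  have hv2 : v ∈ A₂ := hp v (by simp)
  have hv1 : v ∉ A₁ := fun h => hvw (hA v h hv2)
  obtain ⟨P, hP, hPe⟩ := D.pathArc p.bypass p.bypass_isPath hvw (fun e he => Or.inr (hpE' e he))
  have hF : IsArcC (arc s(u, v) ∪ P) (pos u) (pos w) := by
    refine (D.isArc u v heE).trans hP ?_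
    intro z hz hzP
    obtain ⟨e, hep, hze⟩ := hPe z hzP
    have hue : u ∉ e := fun h => hu2 (hpA e hep u h)
    obtain ⟨y, hy, hy', rfl⟩ := D.inter _ heE e (Or.inr (hpE' e hep))
      (by rintro rfl; exact hue (by simp)) z hz hze
    rcases Sym2.mem_iff.1 hy with rfl | rfl
    · exact absurd hy' hue
    · rfl
  have D1 : Drw E₁ A₁ pos arc := D.mono (hE₁.trans (Set.subset_insert _ _)) hA₁ hs
  refine ⟨_, _, D1.addArc hu hw hin hF ?_⟩
  rintro z (hz | hz) hzd
  · left
    rcases mem_dimg.1 hzd with ⟨x, hx, rfl⟩ | ⟨e, he, hze⟩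
    · have := D.posarc _ heE x (hA₁ hx) hz
      rcases Sym2.mem_iff.1 this with rfl | rfl
      · rfl
      · exact absurd hx hv1
    · have hve : v ∉ e := fun h => hv1 (hs e he v h)
      obtain ⟨y, hy, hy', rfl⟩ := D.inter _ heE e (Or.inr (hE₁ he))
        (by rintro rfl; exact hve (by simp)) z hz hze
      rcases Sym2.mem_iff.1 hy with rfl | rfl
      · rfl
      · exact absurd hy' hve
  · right
    obtain ⟨e, hep, hze⟩ := hPe z hz
    have heE' := hpE' e hep
    rcases mem_dimg.1 hzd with ⟨x, hx, rfl⟩ | ⟨e', he', hze'⟩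
    · rw [hA x hx (hpA e hep x (D.posarc e (Or.inr heE') x (hA₁ hx) hze))]
    · have hne : e ≠ e' := by
        rintro rfl
        induction e using Sym2.ind with
        | _ x y =>
          have hx := hA x (hs _ he' x (by simp)) (hpA _ hep x (by simp))
          have hy := hA y (hs _ he' y (by simp)) (hpA _ hep y (by simp))
          exact (D1.isArc x y he').ne (by rw [hx, hy])
      obtain ⟨y, hy, hy', rfl⟩ := D.inter e (Or.inr heE') e' (Or.inr (hE₁ he')) hne z hze hze'
      rw [hA y (hs e' he' y hy') (hpA e hep y hy)]

end


section
variable {V : Type*} {G H : SimpleGraph V} {A A' A₁ A₂ : Set V} {u v w : V}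

/-- Edges of `H` inside `A`. -/
def eset (H : SimpleGraph V) (A : Set V) : Set (Sym2 V) :=
  {e | e ∈ H.edgeSet ∧ ∀ x ∈ e, x ∈ A}

lemma pl_iff : Pl (eset H A) A ↔ Nonempty (PlanarDrawingOn H A) := by
  constructor
  · rintro ⟨pos, arc, D⟩
    have hΦc : Continuous Complex.equivRealProdCLM := Complex.equivRealProdCLM.continuous
    have hΦi : Function.Injective Complex.equivRealProdCLM := Complex.equivRealProdCLM.injective
    refine ⟨⟨fun x => Complex.equivRealProdCLM (pos x), ?_,
      fun e => Complex.equivRealProdCLM '' arc e, ?_, ?_, ?_⟩⟩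
    · intro x hx y hy hxy
      exact D.inj hx hy (hΦi hxy)
    · intro u v hu hv huv
      have he : s(u, v) ∈ eset H A := by
        refine ⟨huv, fun x hx => ?_⟩
        rcases Sym2.mem_iff.1 hx with rfl | rfl <;> assumption
      obtain ⟨f, hc, hi, f0, f1, hf⟩ := D.isArc u v he
      refine ⟨fun t => Complex.equivRealProdCLM (f t), hΦc.comp_continuousOn hc,
        fun a ha b hb hab => hi ha hb (hΦi hab), by simp only [f0], by simp only [f1], ?_⟩
      rw [← hf, Set.image_image]
    · rintro e e' he he' hA hA' hne _ ⟨⟨z, hz, rfl⟩, ⟨z', hz', heq⟩⟩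
      have := hΦi heq
      subst this
      obtain ⟨v, h1, h2, rfl⟩ := D.inter e ⟨he, hA⟩ e' ⟨he', hA'⟩ hne z' hz hz'
      exact ⟨v, hA v h1, h1, h2, rfl⟩
    · rintro e he hA v hv ⟨z, hz, heq⟩
      have := hΦi heq
      subst this
      exact D.posarc e ⟨he, hA⟩ v hv hz
  · rintro ⟨D⟩
    have hΦc : Continuous Complex.equivRealProdCLM.symm := Complex.equivRealProdCLM.symm.continuous
    have hΦi : Function.Injective Complex.equivRealProdCLM.symm :=
      Complex.equivRealProdCLM.symm.injective
    refine ⟨fun x => Complex.equivRealProdCLM.symm (D.pos x),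
      fun e => Complex.equivRealProdCLM.symm '' D.arc e, fun e he => he.2, ?_, ?_, ?_, ?_⟩
    · intro x hx y hy hxy
      exact D.pos_inj hx hy (hΦi hxy)
    · intro u v he
      obtain ⟨f, hc, hi, f0, f1, hf⟩ := D.arc_spec (he.2 u (by simp)) (he.2 v (by simp)) he.1
      refine ⟨fun t => Complex.equivRealProdCLM.symm (f t), hΦc.comp_continuousOn hc,
        fun a ha b hb hab => hi ha hb (hΦi hab), by simp only [f0], by simp only [f1], ?_⟩
      rw [← hf, Set.image_image]
    · rintro e he e' he' hne _ ⟨z, hz, rfl⟩ ⟨z', hz', heq⟩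
      have := hΦi heq
      subst this
      obtain ⟨v, -, h1, h2, rfl⟩ := D.arc_inter he.1 he'.1 he.2 he'.2 hne ⟨hz, hz'⟩
      exact ⟨v, h1, h2, rfl⟩
    · rintro e he v hv ⟨z, hz, heq⟩
      have := hΦi heq
      subst this
      exact D.pos_arc he.1 he.2 v hv hz

lemma mem_addEdge_edgeSet {e : Sym2 V} :
    e ∈ (addEdge G u v).edgeSet ↔ e ∈ G.edgeSet ∨ (e = s(u, v) ∧ u ≠ v) := by
  induction e using Sym2.ind with
  | _ x y =>
    simp only [addEdge, mem_edgeSet, sup_adj, fromEdgeSet_adj, Set.mem_singleton_iff, Sym2.eq_iff]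
    constructor
    · rintro (h | ⟨⟨rfl, rfl⟩ | ⟨rfl, rfl⟩, hne⟩)
      · exact Or.inl h
      · exact Or.inr ⟨Or.inl ⟨rfl, rfl⟩, hne⟩
      · exact Or.inr ⟨Or.inr ⟨rfl, rfl⟩, hne.symm⟩
    · rintro (h | ⟨⟨rfl, rfl⟩ | ⟨rfl, rfl⟩, hne⟩)
      · exact Or.inl h
      · exact Or.inr ⟨Or.inl ⟨rfl, rfl⟩, hne⟩
      · exact Or.inr ⟨Or.inr ⟨rfl, rfl⟩, hne.symm⟩

/-- The part of `G + uv` on `A` is planar. -/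
def PE (G : SimpleGraph V) (u v : V) (A : Set V) : Prop := Pl (eset (addEdge G u v) A) A

lemma eset_addEdge_self : eset (addEdge G u u) A = eset G A := by
  ext e; simp [eset, mem_addEdge_edgeSet]

lemma PE_self : PE G u u A ↔ Pl (eset G A) A := by rw [PE, eset_addEdge_self]

lemma addEdge_comm' : addEdge G u v = addEdge G v u := by
  rw [addEdge, addEdge, Sym2.eq_swap]

lemma PE_comm : PE G u v A ↔ PE G v u A := by rw [PE, PE, addEdge_comm']

lemma eset_addEdge (hu : u ∈ A) (hv : v ∈ A) (huv : u ≠ v) :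
    eset (addEdge G u v) A = insert s(u, v) (eset G A) := by
  ext e
  simp only [eset, mem_addEdge_edgeSet, Set.mem_ofPred_eq, Set.mem_insert_iff]
  constructor
  · rintro ⟨h | ⟨h, -⟩, h'⟩
    · exact Or.inr ⟨h, h'⟩
    · exact Or.inl h
  · rintro (rfl | ⟨h, h'⟩)
    · refine ⟨Or.inr ⟨rfl, huv⟩, fun x hx => ?_⟩
      rcases Sym2.mem_iff.1 hx with rfl | rfl <;> assumption
    · exact ⟨Or.inl h, h'⟩

lemma PE_of_ne (hu : u ∈ A) (hv : v ∈ A) (huv : u ≠ v) :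
    PE G u v A ↔ Pl (insert s(u, v) (eset G A)) A := by rw [PE, eset_addEdge hu hv huv]

lemma Pl_restrict (h : Pl (eset H A) A) (hA : A' ⊆ A) : Pl (eset H A') A' :=
  h.mono (fun _ he => ⟨he.1, fun x hx => hA (he.2 x hx)⟩) hA (fun _ he => he.2)

/-- A separation of order at most one of `G[A]`. -/
structure GSep (G : SimpleGraph V) (A A₁ A₂ : Set V) (w : V) : Prop where
  union : A₁ ∪ A₂ = A
  cap : ∀ x ∈ A₁, x ∈ A₂ → x = w
  hw : w ∈ A
  edges : ∀ e ∈ eset G A, e ∈ eset G A₁ ∨ e ∈ eset G A₂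

lemma GSep.symm (h : GSep G A A₁ A₂ w) : GSep G A A₂ A₁ w :=
  ⟨by rw [Set.union_comm, h.union], fun x h1 h2 => h.cap x h2 h1, h.hw,
    fun e he => (h.edges e he).symm⟩

lemma GSep.sub1 (h : GSep G A A₁ A₂ w) : A₁ ⊆ A := h.union ▸ Set.subset_union_left
lemma GSep.sub2 (h : GSep G A A₁ A₂ w) : A₂ ⊆ A := h.union ▸ Set.subset_union_right

lemma Pl.glue' [Finite V] {E₁ E₂ : Set (Sym2 V)} (h₁ : Pl E₁ A₁) (h₂ : Pl E₂ A₂) (hw : w ∈ A₁ ∪ A₂)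
    (hA : ∀ x ∈ A₁, x ∈ A₂ → x = w) : Pl (E₁ ∪ E₂) (A₁ ∪ A₂) := by
  rcases hw with hw | hw
  · exact h₁.glue h₂ hw hA
  · rw [Set.union_comm E₁, Set.union_comm A₁]
    exact h₂.glue h₁ hw (fun x h1 h2 => hA x h2 h1)

lemma PE_sep [Finite V] (hG : Pl (eset G A) A) (h : GSep G A A₁ A₂ w) (hu : u ∈ A₁) (hv : v ∈ A₁) :
    PE G u v A ↔ PE G u v A₁ := by
  refine ⟨fun h' => Pl_restrict h' h.sub1, fun h' => ?_⟩
  have := Pl.glue' h' (Pl_restrict hG h.sub2) (h.union ▸ h.hw) h.cap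
  rw [h.union] at this
  refine this.mono ?_ subset_rfl (fun e he => he.2)
  rintro e ⟨he, he'⟩
  rcases mem_addEdge_edgeSet.1 he with h1 | ⟨rfl, hne⟩
  · rcases h.edges e ⟨h1, he'⟩ with h2 | h2
    · exact Or.inl ⟨he, h2.2⟩
    · exact Or.inr h2
  · left
    refine ⟨he, fun x hx => ?_⟩
    rcases Sym2.mem_iff.1 hx with rfl | rfl <;> assumption

lemma PE_contract (hG : Pl (eset G A) A) (h : GSep G A A₁ A₂ w) (hu : u ∈ A₁) (hv : v ∈ A₂)
    (hw1 : w ∈ A₁) (hr : ReachableWithin G A₂ v w) (hP : PE G u v A) :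
    PE G u w A₁ := by
  by_cases huw : u = w
  · subst huw
    rw [PE_self]; exact Pl_restrict hG h.sub1
  have huv : u ≠ v := by rintro rfl; exact huw (h.cap u hu hv)
  rw [PE_of_ne (h.sub1 hu) (h.sub2 hv) huv] at hP
  rw [PE_of_ne hu hw1 huw]
  obtain ⟨p, hp⟩ := hr
  refine hP.contract (fun e he => ⟨he.1, fun x hx => h.sub1 (he.2 x hx)⟩) (fun e he => he.2)
    h.sub1 hu hw1 huw h.cap p hp (fun e he => ⟨p.edges_subset_edgeSet he, fun x hx => ?_⟩)
  exact h.sub2 (hp x (Walk.mem_support_of_mem_edges he hx))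

lemma PE_split [Finite V] (hG : Pl (eset G A) A) (h : GSep G A A₁ A₂ w) (hu : u ∈ A₁) (hv : v ∈ A₂)
    (hw1 : w ∈ A₁) (hw2 : w ∈ A₂) (hr1 : ReachableWithin G A₁ u w)
    (hr2 : ReachableWithin G A₂ v w) :
    PE G u v A ↔ PE G u w A₁ ∧ PE G w v A₂ := by
  constructor
  · intro hP
    refine ⟨PE_contract hG h hu hv hw1 hr2 hP, ?_⟩
    rw [PE_comm]
    exact PE_contract hG h.symm hv hu hw2 hr1 (PE_comm.1 hP)
  · rintro ⟨h1, h2⟩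
    by_cases huw : u = w
    · subst huw
      exact (PE_sep hG h.symm hw2 hv).2 h2
    by_cases hvw : v = w
    · subst hvw
      exact (PE_sep hG h hu hw1).2 h1
    have huv : u ≠ v := by rintro rfl; exact huw (h.cap u hu hv)
    rw [PE_of_ne (h.sub1 hu) (h.sub2 hv) huv]
    rw [PE_of_ne hu hw1 huw] at h1
    rw [PE_comm, PE_of_ne hv hw2 hvw] at h2
    have := h1.glueEdge h2 huw hvw h.cap
    rw [h.union] at this
    refine this.mono (Set.insert_subset_insert (fun e he => h.edges e he)) subset_rfl ?_
    rintro e (rfl | he) x hx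
    · rcases Sym2.mem_iff.1 hx with rfl | rfl
      exacts [h.sub1 hu, h.sub2 hv]
    · exact he.2 x hx

/-! ### Combinatorics of blocks -/

lemma ReachableWithin.symm' (h : ReachableWithin G A u v) : ReachableWithin G A v u := by
  obtain ⟨p, hp⟩ := h
  exact ⟨p.reverse, fun x hx => hp x (by simpa using hx)⟩

lemma ReachableWithin.trans' (h : ReachableWithin G A u v) (h' : ReachableWithin G A v w) :
    ReachableWithin G A u w := by
  obtain ⟨p, hp⟩ := h
  obtain ⟨q, hq⟩ := h'
  refine ⟨p.append q, fun x hx => ?_⟩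
  rcases (Walk.mem_support_append_iff _ _).1 hx with h | h
  exacts [hp x h, hq x h]

lemma ReachableWithin.mono' (h : ReachableWithin G A u v) (hA : A ⊆ A') :
    ReachableWithin G A' u v := by
  obtain ⟨p, hp⟩ := h
  exact ⟨p, fun x hx => hA (hp x hx)⟩

lemma exists_sep (hA : A.Nonempty) (hb : ¬ BiconnectedOn G A) :
    ∃ A₁ A₂ w, GSep G A A₁ A₂ w ∧ A₁ ⊂ A ∧ A₂ ⊂ A := by
  obtain ⟨S, w, hSw, hSA, hw, hne, hnc⟩ : ∃ (S : Set V) (w : V), S ⊆ {w} ∧ S ⊆ A ∧ w ∈ A ∧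
      (A \ S).Nonempty ∧ ¬ ConnectedOn G (A \ S) := by
    by_cases hc : ConnectedOn G A
    · have : ∃ w ∈ A, (A \ {w}).Nonempty ∧ ¬ ConnectedOn G (A \ {w}) := by
        by_contra hcon
        push Not at hcon
        exact hb ⟨hc, hcon⟩
      obtain ⟨w, hw, h1, h2⟩ := this
      exact ⟨{w}, w, subset_rfl, by simpa using hw, hw, h1, h2⟩
    · obtain ⟨w, hw⟩ := hA
      exact ⟨∅, w, by simp, by simp, hw, ⟨w, by simpa using hw⟩, by simpa using hc⟩
  have : ∃ u ∈ A \ S, ∃ v ∈ A \ S, ¬ ReachableWithin G (A \ S) u v := by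
    by_contra hcon
    push Not at hcon
    exact hnc ⟨hne, fun u hu v hv => hcon u hu v hv⟩
  obtain ⟨u, hu, v, hv, huv⟩ := this
  set R : Set V := {x | x ∈ A \ S ∧ ReachableWithin G (A \ S) u x} with hR
  have hRstep : ∀ x ∈ R, ∀ y ∈ A \ S, G.Adj x y → y ∈ R := by
    rintro x ⟨hx, hux⟩ y hy hxy
    refine ⟨hy, hux.trans' ⟨hxy.toWalk, ?_⟩⟩
    intro z hz
    have : z = x ∨ z = y := by simpa using hz
    rcases this with rfl | rfl <;> assumption
  have huR : u ∈ R := ⟨hu, Walk.nil, by simpa using hu⟩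
  have hvR : v ∉ R := fun h => huv h.2
  have key : ∀ x y, x ∈ A → y ∈ A → G.Adj x y →
      (x ∈ R ∪ S ∧ y ∈ R ∪ S) ∨ (x ∈ A \ R ∧ y ∈ A \ R) := by
    intro x y hx hy hxy
    by_cases hxR : x ∈ R
    · left
      refine ⟨Or.inl hxR, ?_⟩
      by_cases hyS : y ∈ S
      · exact Or.inr hyS
      · exact Or.inl (hRstep x hxR y ⟨hy, hyS⟩ hxy)
    · by_cases hyR : y ∈ R
      · left
        refine ⟨?_, Or.inl hyR⟩
        by_cases hxS : x ∈ S
        · exact Or.inr hxS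
        · exact Or.inl (hRstep y hyR x ⟨hx, hxS⟩ hxy.symm)
      · exact Or.inr ⟨⟨hx, hxR⟩, ⟨hy, hyR⟩⟩
  have hs1 : R ∪ S ⊆ A := by
    rintro x (hx | hx)
    exacts [hx.1.1, hSA hx]
  refine ⟨R ∪ S, A \ R, w, ⟨?_, ?_, hw, ?_⟩, ?_, ?_⟩
  · ext x
    constructor
    · rintro (h | h)
      exacts [hs1 h, h.1]
    · intro hx
      by_cases h : x ∈ R
      · exact Or.inl (Or.inl h)
      · exact Or.inr ⟨hx, h⟩
  · rintro x (hx | hx) hx'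
    · exact absurd hx hx'.2
    · exact hSw hx
  · rintro e ⟨he, he'⟩
    induction e using Sym2.ind with
    | _ x y =>
      rcases key x y (he' x (by simp)) (he' y (by simp)) he with h | h
      · left
        refine ⟨he, fun z hz => ?_⟩
        rcases Sym2.mem_iff.1 hz with rfl | rfl
        exacts [h.1, h.2]
      · right
        refine ⟨he, fun z hz => ?_⟩
        rcases Sym2.mem_iff.1 hz with rfl | rfl
        exacts [h.1, h.2]
  · refine ⟨hs1, fun h => ?_⟩
    rcases h hv.1 with h | h
    exacts [hvR h, hv.2 h]
  · exact ⟨Set.sdiff_subset, fun h => (h hu.1).2 huR⟩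

lemma GSep.walk (h : GSep G A A₁ A₂ w) {x y : V} (p : G.Walk x y) (hpA : ∀ z ∈ p.support, z ∈ A)
    (hpS : ∀ z ∈ p.support, z ∈ A₁ → z ∉ A₂) (hx : x ∈ A₂) : y ∈ A₂ := by
  induction p with
  | nil => exact hx
  | @cons x x' y hadj p ih =>
    apply ih (fun z hz => hpA z (by simp [hz])) (fun z hz => hpS z (by simp [hz]))
    have he : s(x, x') ∈ eset G A := by
      refine ⟨hadj, fun z hz => ?_⟩
      rcases Sym2.mem_iff.1 hz with rfl | rfl
      · exact hpA _ (by simp)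
      · exact hpA _ (by simp)
    rcases h.edges _ he with h1 | h1
    · exact absurd hx (hpS x (by simp) (h1.2 x (by simp)))
    · exact h1.2 x' (by simp)

lemma GSep.bicon (h : GSep G A A₁ A₂ w) {B : Set V} (hB : BiconnectedOn G B) (hBA : B ⊆ A) :
    B ⊆ A₁ ∨ B ⊆ A₂ := by
  by_contra hcon
  push Not at hcon
  obtain ⟨h1, h2⟩ := hcon
  obtain ⟨x, hx, hx1⟩ := Set.not_subset.1 h1
  obtain ⟨y, hy, hy2⟩ := Set.not_subset.1 h2
  have hxA : x ∈ A₂ := by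
    have := hBA hx
    rw [← h.union] at this
    exact this.resolve_left hx1
  have hyA : y ∈ A₁ := by
    have := hBA hy
    rw [← h.union] at this
    exact this.resolve_right hy2
  have : ∃ p : G.Walk x y, (∀ z ∈ p.support, z ∈ B) ∧ ∀ z ∈ p.support, z ∈ A₁ → z ∉ A₂ := by
    by_cases hc : w ∈ A₁ ∧ w ∈ A₂ ∧ w ∈ B
    · have hxw : x ≠ w := by rintro rfl; exact hx1 hc.1
      have hyw : y ≠ w := by rintro rfl; exact hy2 hc.2.1
      obtain ⟨p, hp⟩ := (hB.2 w hc.2.2 ⟨x, hx, hxw⟩).2 (u := x) ⟨hx, hxw⟩ (v := y) ⟨hy, hyw⟩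
      exact ⟨p, fun z hz => (hp z hz).1, fun z hz hz1 hz2 => (hp z hz).2 (h.cap z hz1 hz2)⟩
    · obtain ⟨p, hp⟩ := hB.1.2 hx hy
      refine ⟨p, hp, fun z hz hz1 hz2 => hc ?_⟩
      have := h.cap z hz1 hz2
      subst this
      exact ⟨hz1, hz2, hp z hz⟩
  obtain ⟨p, hp, hp'⟩ := this
  exact hy2 (h.walk p (fun z hz => hBA (hp z hz)) hp' hxA)

/-- A chain of blocks with consecutive attachment vertices. -/
structure Chain (G : SimpleGraph V) (B : ℕ → Set V) (p : ℕ → V) (l h : ℕ) : Prop where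
  lt : l < h
  block : ∀ i, l ≤ i → i < h → IsBlock G (B i)
  left : ∀ i, l ≤ i → i < h → p i ∈ B i
  right : ∀ i, l ≤ i → i < h → p (i + 1) ∈ B i
  injB : ∀ i j, l ≤ i → i < j → j < h → B i ≠ B j
  injp : ∀ i j, l < i → i < j → j < h → p i ≠ p j

lemma Chain.restrict {B : ℕ → Set V} {p : ℕ → V} {l h l' h' : ℕ} (c : Chain G B p l h)
    (hl : l ≤ l') (hh : h' ≤ h) (hlt : l' < h') : Chain G B p l' h' where
  lt := hlt
  block i h1 h2 := c.block i (by omega) (by omega)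
  left i h1 h2 := c.left i (by omega) (by omega)
  right i h1 h2 := c.right i (by omega) (by omega)
  injB i j h1 h2 h3 := c.injB i j (by omega) h2 (by omega)
  injp i j h1 h2 h3 := c.injp i j (by omega) h2 (by omega)

lemma Chain.reach {B : ℕ → Set V} {p : ℕ → V} {l h : ℕ} (c : Chain G B p l h)
    (hA : ∀ i, l ≤ i → i < h → B i ⊆ A) : ReachableWithin G A (p l) (p h) := by
  have key : ∀ j, l + j < h → ReachableWithin G A (p l) (p (l + j + 1)) := by
    intro j
    induction j with
    | zero =>
      intro hj
      exact ((c.block l le_rfl c.lt).1.1.2 (c.left l le_rfl c.lt) (c.right l le_rfl c.lt)).mono'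
        (hA l le_rfl c.lt)
    | succ j ih =>
      intro hj
      refine (ih (by omega)).trans' ?_
      have h1 : l ≤ l + j + 1 := by omega
      have h2 : l + j + 1 < h := by omega
      exact ((c.block _ h1 h2).1.1.2 (c.left _ h1 h2) (c.right _ h1 h2)).mono' (hA _ h1 h2)
  have := key (h - l - 1) (by have := c.lt; omega)
  have e : l + (h - l - 1) + 1 = h := by have := c.lt; omega
  rwa [e] at this

lemma chain_step [Finite V] (hG : Pl (eset G Set.univ) Set.univ) (B : ℕ → Set V) (p : ℕ → V)
    (ih : ∀ A' : Set V, A' ⊂ A → ∀ l h, Chain G B p l h → (∀ i, l ≤ i → i < h → B i ⊆ A') →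
      (PE G (p l) (p h) A' ↔ ∀ i, l ≤ i → i < h → PE G (p i) (p (i + 1)) (B i)))
    (hs : GSep G A A₁ A₂ w) (h1 : A₁ ⊂ A) (h2 : A₂ ⊂ A) (l h : ℕ) (c : Chain G B p l h)
    (hA : ∀ i, l ≤ i → i < h → B i ⊆ A) (hl : B l ⊆ A₁) :
    PE G (p l) (p h) A ↔ ∀ i, l ≤ i → i < h → PE G (p i) (p (i + 1)) (B i) := by
  have hGA : Pl (eset G A) A := Pl_restrict hG (Set.subset_univ _)
  have hlt := c.lt
  have hlast : p h ∈ B (h - 1) := by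
    have := c.right (h - 1) (by omega) (by omega)
    rwa [Nat.sub_add_cancel (by omega)] at this
  by_cases hall : ∀ i, l ≤ i → i < h → B i ⊆ A₁
  · rw [PE_sep hGA hs (hl (c.left l le_rfl hlt)) (hall (h - 1) (by omega) (by omega) hlast)]
    exact ih A₁ h1 l h c hall
  · have hex : ∃ j, l ≤ j ∧ j < h ∧ ¬ B j ⊆ A₁ := by
      push Not at hall
      exact hall
    classical
    set j := Nat.find hex with hj
    obtain ⟨hj1, hj2, hj3⟩ := Nat.find_spec hex
    rw [← hj] at hj1 hj2 hj3
    have hbefore : ∀ i, l ≤ i → i < j → B i ⊆ A₁ := by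
      intro i hi hij
      by_contra hcon
      exact Nat.find_min hex hij ⟨hi, by omega, hcon⟩
    have hlj : l < j := lt_of_le_of_ne hj1 (fun h' => hj3 (h' ▸ hl))
    have side : ∀ i, l ≤ i → i < h → B i ⊆ A₁ ∨ B i ⊆ A₂ := fun i hi hi' =>
      hs.bicon (c.block i hi hi').1 (hA i hi hi')
    have hjA : B j ⊆ A₂ := (side j hj1 hj2).resolve_left hj3
    have hpj1 : p j ∈ A₁ := by
      have := c.right (j - 1) (by omega) (by omega)
      rw [Nat.sub_add_cancel (by omega)] at this
      exact hbefore (j - 1) (by omega) (by omega) this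
    have hpj2 : p j ∈ A₂ := hjA (c.left j hj1 hj2)
    have hpw : p j = w := hs.cap _ hpj1 hpj2
    have hafter : ∀ i, j ≤ i → i < h → B i ⊆ A₂ := by
      intro i hi
      induction i, hi using Nat.le_induction with
      | base => exact fun _ => hjA
      | succ i hi ihi =>
        intro hlt'
        rcases side (i + 1) (by omega) hlt' with h' | h'
        · exfalso
          have e1 : p (i + 1) ∈ A₁ := h' (c.left _ (by omega) hlt')
          have e2 : p (i + 1) ∈ A₂ := ihi (by omega) (c.right i (by omega) (by omega))
          exact c.injp j (i + 1) hlj (by omega) hlt' (hpw.trans (hs.cap _ e1 e2).symm)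
        · exact h'
    have c1 := c.restrict le_rfl hj2.le hlj
    have c2 := c.restrict hj1 le_rfl hj2
    have e1 := ih A₁ h1 l j c1 hbefore
    have e2 := ih A₂ h2 j h c2 hafter
    rw [PE_split hGA hs (hl (c.left l le_rfl hlt))
      (hafter (h - 1) (by omega) (by omega) hlast) (hpw ▸ hpj1) (hpw ▸ hpj2)
      (hpw ▸ c1.reach hbefore) (hpw ▸ (c2.reach hafter).symm'), ← hpw, e1, e2]
    constructor
    · rintro ⟨f1, f2⟩ i hi hi'
      by_cases hij : i < j
      · exact f1 i hi hij
      · exact f2 i (by omega) hi'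
    · intro f
      exact ⟨fun i hi hi' => f i hi (by omega), fun i hi hi' => f i (by omega) hi'⟩

theorem chain_main [Finite V] (hG : Pl (eset G Set.univ) Set.univ) (B : ℕ → Set V) (p : ℕ → V)
    (A : Set V) : ∀ l h, Chain G B p l h → (∀ i, l ≤ i → i < h → B i ⊆ A) →
      (PE G (p l) (p h) A ↔ ∀ i, l ≤ i → i < h → PE G (p i) (p (i + 1)) (B i)) := by
  induction A using WellFoundedLT.induction with
  | _ A ih =>
    intro l h c hA
    have hlt := c.lt
    by_cases hb : BiconnectedOn G A
    · have hBA : ∀ i, l ≤ i → i < h → A = B i := fun i hi hi' =>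
        (c.block i hi hi').2 A (hA i hi hi') hb
      have hh : h = l + 1 := by
        by_contra hne
        exact c.injB l (l + 1) le_rfl (by omega) (by omega)
          ((hBA l le_rfl hlt).symm.trans (hBA (l + 1) (by omega) (by omega)))
      subst hh
      constructor
      · intro hP i hi hi'
        have : i = l := by omega
        subst this
        rw [← hBA i le_rfl hlt]
        exact hP
      · intro f
        have := f l le_rfl hlt
        rwa [← hBA l le_rfl hlt] at this
    · obtain ⟨A₁, A₂, w, hs, h1, h2⟩ := exists_sep
        ⟨p l, hA l le_rfl hlt (c.left l le_rfl hlt)⟩ hb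
      rcases hs.bicon (c.block l le_rfl hlt).1 (hA l le_rfl hlt) with hl | hl
      · exact chain_step hG B p ih hs h1 h2 l h c hA hl
      · exact chain_step hG B p ih hs.symm h2 h1 l h c hA hl

lemma inducedOn_planar [Finite V] {B : Set V} (hu : u ∈ B) (hv : v ∈ B) :
    (addEdge (inducedOn G B) u v).IsPlanar ↔ PE G u v B := by
  rw [SimpleGraph.IsPlanar, ← pl_iff, PE]
  have he : eset (addEdge (inducedOn G B) u v) Set.univ = eset (addEdge G u v) B := by
    ext e
    simp only [eset, mem_addEdge_edgeSet, Set.mem_ofPred_eq, Set.mem_univ, implies_true, and_true]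
    induction e using Sym2.ind with
    | _ x y =>
      have hi : (inducedOn G B).Adj x y ↔ G.Adj x y ∧ x ∈ B ∧ y ∈ B := by
        simp only [inducedOn, fromRel_adj]
        constructor
        · rintro ⟨-, ⟨h1, h2, h3⟩ | ⟨h1, h2, h3⟩⟩
          exacts [⟨h3, h1, h2⟩, ⟨h3.symm, h2, h1⟩]
        · rintro ⟨h1, h2, h3⟩
          exact ⟨h1.ne, Or.inl ⟨h2, h3, h1⟩⟩
      simp only [mem_edgeSet, hi, Sym2.mem_iff]
      constructor
      · rintro (⟨h1, h2, h3⟩ | ⟨h1, h2⟩)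
        · refine ⟨Or.inl h1, ?_⟩
          rintro z (rfl | rfl) <;> assumption
        · refine ⟨Or.inr ⟨h1, h2⟩, ?_⟩
          intro z hz
          have : z ∈ s(x, y) := Sym2.mem_iff.2 hz
          rw [h1] at this
          rcases Sym2.mem_iff.1 this with rfl | rfl <;> assumption
      · rintro ⟨h1 | h1, h2⟩
        · exact Or.inl ⟨h1, h2 x (Or.inl rfl), h2 y (Or.inr rfl)⟩
        · exact Or.inr h1
  rw [he]
  exact ⟨fun h => h.mono subset_rfl (Set.subset_univ _) (fun e he => he.2),
    fun h => h.ext (Set.subset_univ _)⟩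

end


theorem stmt3_aux {V : Type*} [Fintype V] (G : SimpleGraph V) (hplanar : G.IsPlanar)
    (a b : V) (k : ℕ) (bc : BCPath G a b k) :
    (addEdge G a b).IsPlanar ↔
      ((addEdge (inducedOn G (bc.Bl 0)) a (bc.c 0)).IsPlanar ∧
       (addEdge (inducedOn G (bc.Bl (Fin.last (k + 1)))) (bc.c (Fin.last k)) b).IsPlanar ∧
       ∀ i : Fin k,
         (addEdge (inducedOn G (bc.Bl i.succ.castSucc))
            (bc.c i.castSucc) (bc.c i.succ)).IsPlanar) := by
  classical
  have hG : Pl (eset G Set.univ) Set.univ := pl_iff.2 hplanar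
  set B : ℕ → Set V := fun i => if h : i < k + 2 then bc.Bl ⟨i, h⟩ else ∅ with hB
  set p : ℕ → V := fun i => if i = 0 then a else
    if h : i - 1 < k + 1 then bc.c ⟨i - 1, h⟩ else b with hp
  have hBi : ∀ i (h : i < k + 2), B i = bc.Bl ⟨i, h⟩ := fun i h => by simp [hB, h]
  have hp0 : p 0 = a := by simp [hp]
  have hpi : ∀ i (h : i < k + 1), p (i + 1) = bc.c ⟨i, h⟩ := fun i h => by
    simp [hp, Nat.lt_succ_iff.1 h]
  have hpl : p (k + 2) = b := by simp [hp]
  have hleft : ∀ i, i < k + 2 → p i ∈ B i := by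
    intro i hi
    rw [hBi i hi]
    rcases i with _ | i
    · rw [hp0]; exact bc.ha
    · rw [hpi i (by omega)]; exact bc.linkR ⟨i, by omega⟩
  have hright : ∀ i, i < k + 2 → p (i + 1) ∈ B i := by
    intro i hi
    rw [hBi i hi]
    rcases Nat.lt_or_ge i (k + 1) with h | h
    · rw [hpi i h]; exact bc.linkL ⟨i, h⟩
    · have : i = k + 1 := by omega
      subst this
      rw [hpl]; exact bc.hb
  have c : Chain G B p 0 (k + 2) := by
    refine ⟨by omega, ?_, fun i _ hi => hleft i hi, fun i _ hi => hright i hi, ?_, ?_⟩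
    · intro i _ hi
      rw [hBi i hi]; exact bc.isBlock _
    · intro i j _ hij hj heq
      rw [hBi i (by omega), hBi j hj] at heq
      have := Fin.mk.inj_iff.1 (bc.Bl_inj heq)
      omega
    · intro i j hi hij hj heq
      obtain ⟨i, rfl⟩ := Nat.exists_eq_succ_of_ne_zero hi.ne'
      obtain ⟨j, rfl⟩ := Nat.exists_eq_succ_of_ne_zero (by omega : j ≠ 0)
      simp only [Nat.succ_eq_add_one] at heq hij hj
      rw [hpi i (by omega), hpi j (by omega)] at heq
      have := Fin.mk.inj_iff.1 (bc.c_inj heq)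
      omega
  have main := chain_main hG B p Set.univ 0 (k + 2) c (fun i _ _ => Set.subset_univ _)
  rw [hp0, hpl] at main
  rw [SimpleGraph.IsPlanar, ← pl_iff]
  refine Iff.trans main ?_
  have e0 : PE G (p 0) (p (0 + 1)) (B 0) ↔
      (addEdge (inducedOn G (bc.Bl 0)) a (bc.c 0)).IsPlanar := by
    rw [inducedOn_planar bc.ha (bc.linkL 0), hp0, hpi 0 (by omega), hBi 0 (by omega)]
    rfl
  have el : PE G (p (k + 1)) (p (k + 1 + 1)) (B (k + 1)) ↔
      (addEdge (inducedOn G (bc.Bl (Fin.last (k + 1)))) (bc.c (Fin.last k)) b).IsPlanar := by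
    rw [inducedOn_planar (B := bc.Bl (Fin.last (k + 1))) (bc.linkR (Fin.last k)) bc.hb, hpi k (by omega), hpl,
      hBi (k + 1) (by omega)]
    rfl
  have em : ∀ i : Fin k, PE G (p (i + 1)) (p (i + 1 + 1)) (B (i + 1)) ↔
      (addEdge (inducedOn G (bc.Bl i.succ.castSucc))
            (bc.c i.castSucc) (bc.c i.succ)).IsPlanar := by
    intro i
    have hi := i.isLt
    rw [inducedOn_planar (B := bc.Bl i.succ.castSucc) (bc.linkR i.castSucc) (bc.linkL i.succ), hpi i (by omega),
      hpi (i + 1) (by omega), hBi (i + 1) (by omega)]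
    rfl
  constructor
  · intro f
    exact ⟨e0.1 (f 0 le_rfl (by omega)), el.1 (f (k + 1) (by omega) (by omega)),
      fun i => (em i).1 (f (i + 1) (by omega) (by have := i.isLt; omega))⟩
  · rintro ⟨f0, fl, fm⟩ i _ hi
    rcases i with _ | i
    · exact e0.2 f0
    · by_cases hik : i < k
      · exact (em ⟨i, hik⟩).2 (fm ⟨i, hik⟩)
      · have : i = k := by omega
        subst this
        exact el.2 fl


/-- Insertion criterion across a BC-tree path: `G + {a,b}` is
planar iff each block on the path stays planar after inserting the corresponding
edge between consecutive cut vertices (resp. `a`, `c_1` and `c_(k+1)`, `b`). -/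
theorem stmt3 {V : Type*} [Fintype V] (G : SimpleGraph V) (hplanar : G.IsPlanar)
    (a b : V) (hconn : G.Reachable a b)
    (hblk : ¬ ∃ B : Set V, IsBlock G B ∧ a ∈ B ∧ b ∈ B)
    (k : ℕ) (bc : BCPath G a b k) :
    (addEdge G a b).IsPlanar ↔
      ((addEdge (inducedOn G (bc.Bl 0)) a (bc.c 0)).IsPlanar ∧
       (addEdge (inducedOn G (bc.Bl (Fin.last (k + 1)))) (bc.c (Fin.last k)) b).IsPlanar ∧
       ∀ i : Fin k,
         (addEdge (inducedOn G (bc.Bl i.succ.castSucc))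
            (bc.c i.castSucc) (bc.c i.succ)).IsPlanar) := by
  exact stmt3_aux G hplanar a b k bc
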